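/- For all β, γ > 0 there exists ε > 0 such that for all α > 0 there is c > 0 for which the following holds. Let A, B be subsets of Z_p (p prime) and let 1 ≤ c₁ ≤ |A|, 1 ≤ c₂ ≤ |B| be integers with c₁c₂ ≥ c·max(|A|, |B|). Suppose 2 ≤ min(|A|, |B|), α|B| ≤ |A| ≤ α⁻¹|B|, |A| + |B| ≤ (1−β)p, and the expectation of |A' + B'|, over A' a uniformly random c₁-element subset of A and B' a uniformly random c₂-element subset of B, is at most |A| + |B| − 1 + ε·min(|A|, |B|). Then there exist arithmetic progressions P and Q in Z_p with the same common difference such that max(|A Δ P|, |B Δ Q|) ≤ γ·min(|A|, |B|). -/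

import Mathlib

open Finset Pointwise

/-- The arithmetic progression `{a, a+d, ..., a+(ℓ-1)d}` in `ZMod p`. -/
def zmodAP (p : ℕ) (a d : ZMod p) (ℓ : ℕ) : Finset (ZMod p) :=
  (Finset.range ℓ).image (fun i : ℕ => a + (i : ZMod p) * d)



section basics
variable {p : ℕ} [Fact p.Prime]

/-- number of representations -/
def rep (A B : Finset (ZMod p)) (z : ZMod p) : ℕ := (A.filter (fun a => z - a ∈ B)).card

/-- truncated count -/
def gg (t : ℕ) (A B : Finset (ZMod p)) : ℕ := ∑ z, min (rep A B z) t

/-- translate -/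
def tr (A : Finset (ZMod p)) (x : ZMod p) : Finset (ZMod p) := A.image (fun a => a + x)

lemma mem_tr {A : Finset (ZMod p)} {x y : ZMod p} : y ∈ tr A x ↔ y - x ∈ A := by
  unfold tr
  simp only [mem_image]
  constructor
  · rintro ⟨a, ha, rfl⟩; simpa using ha
  · intro h; exact ⟨y - x, h, by ring⟩

lemma card_tr (A : Finset (ZMod p)) (x : ZMod p) : (tr A x).card = A.card :=
  card_image_of_injective _ (add_left_injective x)

lemma rep_comm (A B : Finset (ZMod p)) (z : ZMod p) : rep A B z = rep B A z := by
  unfold rep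
  apply card_bij (fun a _ => z - a)
  · intro a ha; simp at ha ⊢; exact ⟨ha.2, ha.1⟩
  · intro a _ b _ h; exact sub_right_injective h
  · intro b hb; simp at hb; exact ⟨z - b, by simp [hb.1, hb.2], by ring⟩

lemma gg_comm (t : ℕ) (A B : Finset (ZMod p)) : gg t A B = gg t B A := by
  unfold gg; simp_rw [rep_comm A B]

lemma rep_le_left (A B : Finset (ZMod p)) (z : ZMod p) : rep A B z ≤ A.card := card_filter_le _ _
lemma rep_le_right (A B : Finset (ZMod p)) (z : ZMod p) : rep A B z ≤ B.card := by
  rw [rep_comm]; exact rep_le_left _ _ _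

lemma sum_rep (A B : Finset (ZMod p)) : ∑ z, rep A B z = A.card * B.card := by
  unfold rep
  simp_rw [card_filter]
  rw [sum_comm]
  have : ∀ a ∈ A, (∑ z : ZMod p, if z - a ∈ B then 1 else 0) = B.card := by
    intro a _
    rw [← card_filter, ← card_tr B a]
    congr 1; ext z; simp [mem_tr]
  rw [sum_congr rfl this]; simp

lemma rep_mono {A A' B B' : Finset (ZMod p)} (h : A ⊆ A') (h' : B ⊆ B') (z : ZMod p) :
    rep A B z ≤ rep A' B' z := by
  apply card_le_card
  intro a; simp only [mem_filter]; exact fun ⟨x, y⟩ => ⟨h x, h' y⟩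

lemma gg_mono {A A' B B' : Finset (ZMod p)} (t : ℕ) (h : A ⊆ A') (h' : B ⊆ B') :
    gg t A B ≤ gg t A' B' :=
  sum_le_sum fun z _ => min_le_min_right _ (rep_mono h h' z)

lemma rep_union_inter (X Y B : Finset (ZMod p)) (z : ZMod p) :
    rep (X ∩ Y) B z + rep (X ∪ Y) B z = rep X B z + rep Y B z := by
  unfold rep
  rw [filter_union, filter_inter_distrib, card_inter_add_card_union]

lemma gg_submod (t : ℕ) (X Y B : Finset (ZMod p)) :
    gg t (X ∩ Y) B + gg t (X ∪ Y) B ≤ gg t X B + gg t Y B := by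
  unfold gg
  rw [← sum_add_distrib, ← sum_add_distrib]
  apply sum_le_sum
  intro z _
  have h1 := rep_union_inter X Y B z
  have h2 : rep (X ∩ Y) B z ≤ rep X B z := rep_mono inter_subset_left subset_rfl z
  have h3 : rep (X ∩ Y) B z ≤ rep Y B z := rep_mono inter_subset_right subset_rfl z
  omega

lemma rep_tr (A B : Finset (ZMod p)) (x z : ZMod p) : rep (tr A x) B z = rep A B (z - x) := by
  unfold rep
  symm
  apply card_bij (fun a _ => a + x)
  · intro a ha; simp only [mem_filter, mem_tr] at ha ⊢
    refine ⟨by simpa using ha.1, ?_⟩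
    have := ha.2
    rwa [show z - (a + x) = z - x - a by ring]
  · intro a _ b _ h; exact add_left_injective x h
  · intro b hb; simp only [mem_filter, mem_tr] at hb
    refine ⟨b - x, ?_, by ring⟩
    simp only [mem_filter]
    refine ⟨hb.1, ?_⟩
    rw [show z - x - (b - x) = z - b by ring]; exact hb.2

lemma gg_tr (t : ℕ) (A B : Finset (ZMod p)) (x : ZMod p) : gg t (tr A x) B = gg t A B := by
  unfold gg
  simp_rw [rep_tr]
  exact Fintype.sum_equiv (Equiv.subRight x) _ _ (fun z => rfl)

lemma rep_split {A B I : Finset (ZMod p)} (hI : I = A ∩ B) (z : ZMod p) :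
    rep (A ∪ B) I z + rep (A \ I) (B \ I) z = rep A B z := by
  subst hI
  have hu : A ∪ B = A ∪ (B \ (A ∩ B)) := by ext; simp
  have e1 : rep (A ∪ B) (A ∩ B) z = rep A (A ∩ B) z + rep (B \ (A ∩ B)) (A ∩ B) z := by
    rw [hu]; unfold rep
    rw [filter_union, card_union_of_disjoint]
    rw [disjoint_left]; intro a; simp; tauto
  have e2 : rep (B \ (A ∩ B)) (A ∩ B) z = rep (A ∩ B) (B \ (A ∩ B)) z := rep_comm _ _ _
  have e3 : rep A (B \ (A ∩ B)) z = rep (A ∩ B) (B \ (A ∩ B)) z + rep (A \ (A ∩ B)) (B \ (A ∩ B)) z := by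
    unfold rep
    rw [← card_union_of_disjoint]
    · congr 1; ext a; simp; tauto
    · rw [disjoint_left]; intro a; simp; tauto
  have e4 : rep A B z = rep A (A ∩ B) z + rep A (B \ (A ∩ B)) z := by
    unfold rep
    rw [← card_union_of_disjoint]
    · congr 1; ext a; simp; tauto
    · rw [disjoint_left]; intro a; simp; tauto
  omega

lemma exists_shift {A B : Finset (ZMod p)} (hA : A.Nonempty) (hA' : A ≠ univ) (hB : 2 ≤ B.card) :
    ∃ e, (A ∩ tr B e).Nonempty ∧ (A ∩ tr B e).card < B.card := by
  by_contra hcon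
  push Not at hcon
  have key : ∀ e, (A ∩ tr B e).Nonempty → tr B e ⊆ A := by
    intro e he
    have h := hcon e he
    rw [← card_tr B e] at h
    have := eq_of_subset_of_card_le (inter_subset_right) h
    rw [← this]; exact inter_subset_left
  obtain ⟨b, hb, c, hc, hbc⟩ := one_lt_card.1 (show 1 < B.card by omega)
  have step : ∀ x ∈ A, x + (c - b) ∈ A := by
    intro x hx
    apply key (x - b)
    · exact ⟨x, by simp [mem_tr, hx, hb]⟩
    · rw [mem_tr]; convert hc using 1; ring
  obtain ⟨a, ha⟩ := hA
  have hn : ∀ n : ℕ, a + n * (c - b) ∈ A := by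
    intro n
    induction n with
    | zero => simpa using ha
    | succ k ih => have := step _ ih; convert this using 1; push_cast; ring
  apply hA'
  rw [eq_univ_iff_forall]
  intro y
  have hne : c - b ≠ 0 := sub_ne_zero.2 (Ne.symm hbc)
  have := hn ((y - a) / (c - b)).val
  rw [ZMod.natCast_zmod_val, div_mul_cancel₀ _ hne] at this
  simpa using this

lemma pollard_aux (n : ℕ) : ∀ (A B : Finset (ZMod p)) (t : ℕ), B.card ≤ n → t ≤ A.card → t ≤ B.card →
    A.card + B.card ≤ p + t → t * (A.card + B.card - t) ≤ gg t A B := by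
  induction n with
  | zero =>
    intro A B t hn _ h2 _
    have : t = 0 := by omega
    simp [this]
  | succ n ih =>
    intro A B t hn h1 h2 h3
    rcases Nat.eq_zero_or_pos t with rfl | ht
    · simp
    rcases eq_or_lt_of_le h2 with h2 | h2
    · have : gg t A B = A.card * B.card := by
        rw [← sum_rep]; unfold gg
        apply sum_congr rfl; intro z _
        rw [h2]; exact min_eq_left (rep_le_right _ _ _)
      rw [this, ← h2, Nat.add_sub_cancel, mul_comm]
    have hA' : A ≠ univ := by
      rintro rfl
      rw [card_univ, ZMod.card] at h3; omega
    obtain ⟨e, he1, he2⟩ := exists_shift (A := A) (B := B) (card_pos.1 (by omega)) hA' (by omega)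
    have hg : gg t A B = gg t A (tr B e) := by rw [gg_comm t A (tr B e), gg_tr, gg_comm]
    rw [hg, ← card_tr B e]
    rw [← card_tr B e] at hn h2 h3 he2
    generalize tr B e = B' at *
    set I := A ∩ B' with hI
    have hIA : I ⊆ A := inter_subset_left
    have hIB : I ⊆ B' := inter_subset_right
    have hc1 : (A ∪ B').card + I.card = A.card + B'.card := card_union_add_card_inter A B'
    have hc2 : (A \ I).card = A.card - I.card := card_sdiff_of_subset hIA
    have hc3 : (B' \ I).card = B'.card - I.card := card_sdiff_of_subset hIB
    have hi0 : 0 < I.card := he1.card_pos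
    have hIA' := card_le_card hIA
    have hs := rep_split (A := A) (B := B') hI
    rcases le_or_gt t I.card with hti | hti
    · have h := ih (A ∪ B') I t (by omega) (by omega) hti (by omega)
      rw [hc1] at h
      refine h.trans (sum_le_sum fun z _ => min_le_min_right _ ?_)
      have := hs z; omega
    · have h := ih (A \ I) (B' \ I) (t - I.card) (by omega) (by omega) (by omega) (by omega)
      have h' : (A ∪ B').card * I.card + gg (t - I.card) (A \ I) (B' \ I) ≤ gg t A B' := by
        rw [← sum_rep]; unfold gg
        rw [← sum_add_distrib]
        apply sum_le_sum
        intro z _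
        have := hs z
        have := rep_le_right (A ∪ B') I z
        omega
      refine le_trans ?_ h'
      refine le_trans ?_ (Nat.add_le_add_left h _)
      rw [hc2, hc3]
      obtain ⟨a, ha⟩ : ∃ a, A.card = t + a := ⟨A.card - t, by omega⟩
      obtain ⟨b, hb⟩ : ∃ b, B'.card = t + b := ⟨B'.card - t, by omega⟩
      obtain ⟨j, hj⟩ : ∃ j, t = I.card + j := ⟨t - I.card, by omega⟩
      have hu : (A ∪ B').card = t + a + b + j := by omega
      rw [hu, ha, hb]
      generalize I.card = i at *
      subst hj
      have e1 : i + j + a + (i + j + b) - (i + j) = i + j + a + b := by omega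
      have e2 : i + j - i = j := by omega
      have e3 : i + j + a - i + (i + j + b - i) - j = j + a + b := by omega
      rw [e1, e2, e3]
      nlinarith

lemma pollard {A B : Finset (ZMod p)} {t : ℕ} (h1 : t ≤ A.card) (h2 : t ≤ B.card)
    (h3 : A.card + B.card ≤ p + t) : t * (A.card + B.card - t) ≤ gg t A B :=
  pollard_aux _ A B t le_rfl h1 h2 h3

end basics

section norms
variable {p : ℕ} [Fact p.Prime]

/-- size of `(C+x) \ C` -/
def nn (C : Finset (ZMod p)) (x : ZMod p) : ℕ := (C.filter (fun c => c + x ∉ C)).card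

/-- ball of the norm -/
def ball (C : Finset (ZMod p)) (ρ : ℕ) : Finset (ZMod p) := univ.filter (fun x => nn C x ≤ ρ)

lemma mem_ball {C : Finset (ZMod p)} {ρ : ℕ} {x : ZMod p} : x ∈ ball C ρ ↔ nn C x ≤ ρ := by
  simp [ball]

lemma nn_add_card (C : Finset (ZMod p)) (x : ZMod p) :
    (C.filter (fun c => c + x ∈ C)).card + nn C x = C.card :=
  card_filter_add_card_filter_not _

lemma card_inter_tr (C : Finset (ZMod p)) (x : ZMod p) :
    (C ∩ tr C x).card = (C.filter (fun c => c + x ∈ C)).card := by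
  symm
  apply card_bij (fun c _ => c + x)
  · intro c hc; simp only [mem_filter, mem_inter, mem_tr] at hc ⊢; simp [hc]
  · intro a _ b _ h; exact add_left_injective x h
  · intro y hy; simp only [mem_filter, mem_inter, mem_tr] at hy ⊢
    exact ⟨y - x, by simp [hy], by simp⟩

lemma inter_tr_add (C : Finset (ZMod p)) (x : ZMod p) : (C ∩ tr C x).card + nn C x = C.card := by
  rw [card_inter_tr]; exact nn_add_card C x

lemma nn_le (C : Finset (ZMod p)) (x : ZMod p) : nn C x ≤ C.card := card_filter_le _ _

lemma nn_zero (C : Finset (ZMod p)) : nn C 0 = 0 := by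
  unfold nn; rw [card_eq_zero, filter_eq_empty_iff]; intro x hx; simpa using hx

lemma nn_neg (C : Finset (ZMod p)) (x : ZMod p) : nn C (-x) = nn C x := by
  have h1 := nn_add_card C x
  have h2 := inter_tr_add C (-x)
  have : (C ∩ tr C (-x)).card = (C.filter (fun c => c + x ∈ C)).card := by
    congr 1; ext y; simp [mem_tr]
  omega

lemma nn_add (C : Finset (ZMod p)) (x y : ZMod p) : nn C (x + y) ≤ nn C x + nn C y := by
  have : (C.filter (fun c => c + (x + y) ∉ C)) ⊆
      (C.filter (fun c => c + x ∉ C)) ∪ tr (C.filter (fun c => c + y ∉ C)) (-x) := by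
    intro c
    simp only [mem_filter, mem_union, mem_tr]
    rintro ⟨h1, h2⟩
    by_cases h : c + x ∈ C
    · right
      simp only [sub_neg_eq_add, h, true_and]
      rwa [add_assoc]
    · left; exact ⟨h1, h⟩
  have h := card_le_card this
  have h' := card_union_le (C.filter (fun c => c + x ∉ C)) (tr (C.filter (fun c => c + y ∉ C)) (-x))
  rw [card_tr] at h'
  exact h.trans h'

lemma nn_sub (C : Finset (ZMod p)) (x y : ZMod p) : nn C (x - y) ≤ nn C x + nn C y := by
  rw [sub_eq_add_neg, ← nn_neg C y]; exact nn_add C x (-y)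

lemma nn_compl (C : Finset (ZMod p)) (x : ZMod p) : nn Cᶜ x = nn C x := by
  have h1 := nn_add_card C x
  have h2 : (C.filter (fun c => c + x ∈ C)).card + nn Cᶜ x = C.card := by
    unfold nn
    rw [← card_tr C (-x), ← card_union_of_disjoint]
    · congr 1; ext c; simp [mem_tr]; tauto
    · rw [disjoint_left]; intro c; simp; tauto
  omega

lemma sum_inter (C : Finset (ZMod p)) : ∑ x, (C.filter (fun c => c + x ∈ C)).card = C.card * C.card := by
  simp_rw [card_filter]
  rw [sum_comm]
  have : ∀ a ∈ C, (∑ x : ZMod p, if a + x ∈ C then 1 else 0) = C.card := by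
    intro a _
    rw [← card_filter, ← card_tr C (-a)]
    congr 1; ext z; simp [mem_tr, add_comm]
  rw [sum_congr rfl this]; simp

lemma sum_balls (C : Finset (ZMod p)) (r n : ℕ) (h : n * r ≤ C.card) :
    r * ∑ j ∈ range n, (ball C (j * r)).card ≤ C.card * C.card := by
  rw [← sum_inter]
  unfold ball
  simp_rw [card_filter]
  rw [sum_comm, mul_sum]
  apply sum_le_sum
  intro x _
  rw [← card_filter, ← card_filter]
  have h1 := nn_add_card C x
  by_cases hx : ∃ j, j < n ∧ nn C x ≤ j * r
  · classical
    have hs := Nat.find_spec hx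
    set j0 := Nat.find hx
    have hsub : (range n).filter (fun j => nn C x ≤ j * r) ⊆ Ico j0 n := by
      intro j hj
      simp only [mem_filter, mem_range, mem_Ico] at hj ⊢
      exact ⟨Nat.find_min' hx hj, hj.1⟩
    have hc := card_le_card hsub
    rw [Nat.card_Ico] at hc
    have : r * (n - j0) + j0 * r = n * r := by
      rw [mul_comm r, ← add_mul, Nat.sub_add_cancel hs.1.le]
    have h2 := Nat.mul_le_mul_left r hc
    omega
  · have : (range n).filter (fun j => nn C x ≤ j * r) = ∅ := by
      rw [filter_eq_empty_iff]; intro j hj hh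
      exact hx ⟨j, mem_range.1 hj, hh⟩
    rw [this]; simp

lemma ball_growth (C W : Finset (ZMod p)) (r ρ : ℕ) (hW : W.Nonempty) (h : ∀ w ∈ W, nn C w ≤ r) (i : ℕ) :
    min p ((ball C ρ).card + i * (W.card - 1)) ≤ (ball C (ρ + i * r)).card := by
  induction i with
  | zero => simp
  | succ i ih =>
    have hne : (ball C (ρ + i * r)).Nonempty := ⟨0, by simp [mem_ball, nn_zero]⟩
    have hcd := ZMod.cauchy_davenport (p := p) Fact.out hne hW
    have hsub : ball C (ρ + i * r) + W ⊆ ball C (ρ + (i + 1) * r) := by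
      intro z hz
      obtain ⟨x, hx, w, hw, rfl⟩ := mem_add.1 hz
      rw [mem_ball] at hx ⊢
      have := nn_add C x w
      have := h w hw
      rw [add_mul]; omega
    have h1 := hcd.trans (card_le_card hsub)
    have := hW.card_pos
    rw [add_mul]
    omega

lemma sum_range_id_real (n : ℕ) : ∑ i ∈ range n, (i : ℝ) = n * (n - 1) / 2 := by
  induction n with
  | zero => simp
  | succ n ih => rw [sum_range_succ, ih]; push_cast; ring

lemma sum_range_quad (n : ℕ) (N : ℝ) : ∑ i ∈ range n, (i : ℝ) * (N - i) =
    N * (n * (n - 1) / 2) - n * (n - 1) * (2 * n - 1) / 6 := by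
  induction n with
  | zero => simp
  | succ n ih => rw [sum_range_succ, ih]; push_cast; ring

lemma lemI2 (C W : Finset (ZMod p)) (r n : ℕ) (κ : ℝ) (hκ : 0 < κ) (hκ1 : κ ≤ 1) (hr : 0 < r)
    (h1 : n * r ≤ C.card) (h2 : C.card < (n + 1) * r) (h3 : 2 * C.card ≤ p) (hW : W.Nonempty)
    (h : ∀ w ∈ W, nn C w ≤ r) (hn : 40 ≤ κ * n) : (W.card : ℝ) - 1 ≤ (2 + κ) * r := by
  by_contra hcon
  push Not at hcon
  have hwp := hW.card_pos
  have hrR : (0:ℝ) < r := by exact_mod_cast hr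
  have hn40 : (40 : ℝ) ≤ n := by nlinarith [(Nat.cast_nonneg n : (0:ℝ) ≤ n)]
  have hb : ∀ j ∈ range n, (2 * r * (j:ℝ) + κ * r / n * (j * (n - j)) : ℝ) ≤ ((ball C (j * r)).card : ℝ) := by
    intro j hj
    have hjn : (j : ℝ) ≤ n := by exact_mod_cast (mem_range.1 hj).le
    have hg := ball_growth C W r 0 hW h j
    rw [zero_add] at hg
    have hg' : min (p : ℝ) (((ball C 0).card : ℝ) + j * ((W.card : ℝ) - 1)) ≤ ((ball C (j * r)).card : ℝ) := by
      have : (min (p : ℝ) (((ball C 0).card : ℝ) + j * ((W.card : ℝ) - 1))) =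
        ((min p ((ball C 0).card + j * (W.card - 1)) : ℕ) : ℝ) := by
        push_cast [Nat.cast_sub (show 1 ≤ W.card from hwp)]; rfl
      rw [this]; exact_mod_cast hg
    refine le_trans (le_min ?_ ?_) hg'
    · have hp : (2 * (n * r) : ℝ) ≤ p := by exact_mod_cast (by omega : 2 * (n * r) ≤ p)
      have : κ * r / n * (j * (n - j)) ≤ 2 * r * (n - j) := by
        have e : κ * r / n * (j * (n - j)) = (κ * (j / n)) * (r * (n - j)) := by ring
        rw [e]
        have q1 : (j : ℝ) / n ≤ 1 := div_le_one_of_le₀ hjn (by linarith)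
        have q2 : 0 ≤ r * ((n : ℝ) - j) := by apply mul_nonneg <;> linarith
        have q3 : κ * (j / n) ≤ 2 := by nlinarith
        nlinarith
      linarith
    · have q1 : κ * r / n * (j * (n - j)) ≤ κ * r * j := by
        have e : κ * r / n * (j * (n - j)) = (κ * r * j) * ((n - j) / n) := by ring
        rw [e]
        have : ((n:ℝ) - j) / n ≤ 1 := div_le_one_of_le₀ (by simp) (by linarith)
        have : 0 ≤ κ * r * j := by positivity
        nlinarith
      have q2 : (j : ℝ) * ((2 + κ) * r) ≤ j * ((W.card : ℝ) - 1) :=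
        mul_le_mul_of_nonneg_left hcon.le (by positivity)
      have q3 : (0:ℝ) ≤ ((ball C 0).card : ℝ) := by positivity
      linarith
  have hs := sum_balls C r n h1
  have hs' : (r : ℝ) * ∑ j ∈ range n, ((ball C (j * r)).card : ℝ) ≤ C.card * C.card := by exact_mod_cast hs
  have hlow := mul_le_mul_of_nonneg_left (sum_le_sum hb) hrR.le
  rw [sum_add_distrib, ← mul_sum, ← mul_sum, sum_range_id_real, sum_range_quad] at hlow
  have hup : (C.card : ℝ) * C.card < ((n + 1) * r) * ((n + 1) * r) := by
    have : (C.card : ℝ) < (n + 1) * r := by exact_mod_cast h2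
    have h0 : (0:ℝ) ≤ C.card := by positivity
    nlinarith
  have key : (r:ℝ) * (2 * r * (n * (n - 1) / 2) + κ * r / n * (n * (n * (n - 1) / 2) - n * (n - 1) * (2 * n - 1) / 6)) =
    r * r * (n * (n - 1) + κ * (n - 1) * (n + 1) / 6) := by
    field_simp; ring
  rw [key] at hlow
  have : (r:ℝ) * r * (n * (n - 1) + κ * (n - 1) * (n + 1) / 6) < r * r * ((n + 1) * (n+1)) := by linarith
  have := lt_of_mul_lt_mul_left this (by positivity)
  nlinarith

lemma lemMu (C W : Finset (ZMod p)) (r n : ℕ) (hr : 0 < r)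
    (h1 : n * r ≤ C.card) (h2 : C.card < (n + 1) * r) (h3 : 2 * C.card ≤ p) (hW : W.Nonempty)
    (h : ∀ w ∈ W, nn C w ≤ r) (hn : 10000 ≤ n)
    (hc : (C.card : ℝ) * (2 * r - ((W.card : ℝ) - 1)) ≤ 2 * r ^ 2) :
    (ball C (2000 * r)).card ≤ 4050 * r ∧ 1999 * r ≤ (ball C (1000 * r)).card := by
  have hwp := hW.card_pos
  have hrR : (0:ℝ) < r := by exact_mod_cast hr
  have hnR : (10000 : ℝ) ≤ n := by exact_mod_cast hn
  have hn0 : (0:ℝ) < n := by linarith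
  set L : ℝ := 2 * r * (1 - 1 / n) with hL
  have hin : (1 : ℝ) / n ≤ 1 := div_le_one_of_le₀ (by linarith) (by linarith)
  have hin0 : (0 : ℝ) < 1 / n := by positivity
  have hL2 : L ≤ 2 * r := by nlinarith
  have hL0 : 0 ≤ L := by rw [hL]; apply mul_nonneg <;> linarith
  have hw : L ≤ (W.card : ℝ) - 1 := by
    by_contra hcon
    push Not at hcon
    have hbn : (n * r : ℝ) ≤ C.card := by exact_mod_cast h1
    have e : 2 * r - L = 2 * r / n := by rw [hL]; ring
    have : 2 * r / n < 2 * r - ((W.card : ℝ) - 1) := by linarith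
    have h5 : (n * r : ℝ) * (2 * r / n) < C.card * (2 * r - ((W.card : ℝ) - 1)) := by
      have q : (0:ℝ) < 2 * r / n := by positivity
      have q' : (0:ℝ) < n * r := by positivity
      nlinarith
    have e2 : (n * r : ℝ) * (2 * r / n) = 2 * r ^ 2 := by field_simp
    linarith
  have hp : (2 * (n * r) : ℝ) ≤ p := by exact_mod_cast (by omega : 2 * (n * r) ≤ p)
  have grow : ∀ ρ j : ℕ, min (p : ℝ) (((ball C ρ).card : ℝ) + j * L) ≤ ((ball C (ρ + j * r)).card : ℝ) := by
    intro ρ j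
    have hg := ball_growth C W r ρ hW h j
    have : (min (p : ℝ) (((ball C ρ).card : ℝ) + j * ((W.card : ℝ) - 1))) =
        ((min p ((ball C ρ).card + j * (W.card - 1)) : ℕ) : ℝ) := by
      push_cast [Nat.cast_sub (show 1 ≤ W.card from hwp)]; rfl
    refine le_trans (min_le_min_left _ ?_) (le_trans this.le (by exact_mod_cast hg))
    have : (j:ℝ) * L ≤ j * ((W.card : ℝ) - 1) := mul_le_mul_of_nonneg_left hw (by positivity)
    linarith
  have low : ∀ j : ℕ, j ≤ n → (j : ℝ) * L ≤ ((ball C (j * r)).card : ℝ) := by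
    intro j hj
    have hjn : (j : ℝ) ≤ n := by exact_mod_cast hj
    have := grow 0 j
    rw [zero_add] at this
    refine le_trans (le_min ?_ ?_) this
    · have : (j:ℝ) * L ≤ n * (2 * r) := mul_le_mul hjn hL2 hL0 (by linarith)
      linarith
    · have q3 : (0:ℝ) ≤ ((ball C 0).card : ℝ) := by positivity
      linarith
  constructor
  · by_contra hcon
    push Not at hcon
    have hcon' : (4050 * r : ℝ) ≤ ((ball C (2000 * r)).card : ℝ) := by exact_mod_cast hcon.le
    have hb : ∀ j ∈ range n, (j * L + (50 * r / n * (n - j) - if j ∈ range 2000 then 50 * (r:ℝ) else 0) : ℝ) ≤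
        ((ball C (j * r)).card : ℝ) := by
      intro j hj
      have hj' := (mem_range.1 hj).le
      have hjn : (j : ℝ) ≤ n := by exact_mod_cast hj'
      have e1 : 50 * r / n * (n - j) = 50 * r * ((n - j) / n : ℝ) := by ring
      have e2 : ((n:ℝ) - j) / n ≤ 1 := div_le_one_of_le₀ (by simp) (by linarith)
      have e3 : 50 * r / n * (n - j) ≤ 50 * (r:ℝ) := by rw [e1]; nlinarith
      split_ifs with hlt
      · have := low j hj'
        linarith
      · have hge : 2000 ≤ j := by simpa using hlt
        obtain ⟨i, rfl⟩ := Nat.exists_eq_add_of_le hge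
        have hg := grow (2000 * r) i
        rw [← add_mul] at hg
        refine le_trans (le_min ?_ ?_) hg
        · have q1 : ((2000 + i : ℕ):ℝ) * L ≤ ((2000 + i : ℕ):ℝ) * (2 * r) :=
            mul_le_mul_of_nonneg_left hL2 (by positivity)
          have q2 : 50 * r / n * (n - ((2000 + i : ℕ):ℝ)) ≤ 2 * r * (n - ((2000 + i : ℕ):ℝ)) := by
            apply mul_le_mul_of_nonneg_right _ (by linarith)
            rw [div_le_iff₀ hn0]; nlinarith
          linarith
        · push_cast at e3 ⊢
          linarith
    have hs := sum_balls C r n h1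
    have hs' : (r : ℝ) * ∑ j ∈ range n, ((ball C (j * r)).card : ℝ) ≤ C.card * C.card := by exact_mod_cast hs
    have hlow := mul_le_mul_of_nonneg_left (sum_le_sum hb) hrR.le
    rw [sum_add_distrib, sum_sub_distrib, ← sum_mul, ← mul_sum, sum_sub_distrib, sum_range_id_real] at hlow
    have hite : ∑ j ∈ range n, (if j ∈ range 2000 then 50 * (r:ℝ) else 0) ≤ 2000 * (50 * r) := by
      rw [← sum_filter, sum_const, nsmul_eq_mul]
      apply mul_le_mul_of_nonneg_right _ (by positivity)
      have : (filter (fun j => j ∈ range 2000) (range n)).card ≤ (range 2000).card :=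
        card_le_card (fun x hx => (mem_filter.1 hx).2)
      rw [card_range] at this
      exact_mod_cast this
    simp only [sum_const, card_range, nsmul_eq_mul] at hlow
    have hup : (C.card : ℝ) * C.card < ((n + 1) * r) * ((n + 1) * r) := by
      have : (C.card : ℝ) < (n + 1) * r := by exact_mod_cast h2
      have h0 : (0:ℝ) ≤ C.card := by positivity
      nlinarith
    have fin : (r:ℝ) * (n * (n - 1) / 2 * L + (50 * r / n * (n * n - n * (n - 1) / 2) - 2000 * (50 * r))) <
        ((n + 1) * r) * ((n + 1) * r) := by
      refine lt_of_le_of_lt ?_ hup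
      refine le_trans ?_ hs'
      refine le_trans ?_ hlow
      apply mul_le_mul_of_nonneg_left _ hrR.le
      linarith
    have key : (r:ℝ) * (n * (n - 1) / 2 * L + (50 * r / n * (n * n - n * (n - 1) / 2) - 2000 * (50 * r))) =
      r * r * ((n - 1) * (n - 1) + 25 * (n + 1) - 100000) := by
      rw [hL]; field_simp; ring
    rw [key] at fin
    have : (r:ℝ) * r * ((n - 1) * (n - 1) + 25 * (n + 1) - 100000) < r * r * ((n + 1) * (n+1)) := by linarith
    have := lt_of_mul_lt_mul_left this (by positivity)
    nlinarith
  · have := low 1000 (by omega)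
    have h9 : (1999 * r : ℝ) ≤ 1000 * L := by
      rw [hL]
      have : (1:ℝ) / n ≤ 1 / 10000 := one_div_le_one_div_of_le (by norm_num) hnR
      nlinarith
    have : (1999 * r : ℝ) ≤ ((ball C (1000 * r)).card : ℝ) := by push_cast at this; linarith
    exact_mod_cast this

end norms

section fourier
variable {p : ℕ} [Fact p.Prime]

/-- Fourier coefficient -/
noncomputable def fc (C : Finset (ZMod p)) (ξ : ZMod p) : ℂ := ∑ c ∈ C, ZMod.stdAddChar (ξ * c)

lemma fc_sum (C : Finset (ZMod p)) (v : ZMod p) :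
    ∑ ξ, Complex.normSq (fc C ξ) * (ZMod.stdAddChar (ξ * v) : ℂ).re
      = p * (C.filter (fun c => c + v ∈ C)).card := by
  have key : ∑ ξ, (Complex.normSq (fc C ξ) : ℂ) * (ZMod.stdAddChar (ξ * v) : ℂ)
      = p * (C.filter (fun c => c + v ∈ C)).card := by
    have h1 : ∀ ξ : ZMod p, (Complex.normSq (fc C ξ) : ℂ) * (ZMod.stdAddChar (ξ * v) : ℂ)
        = ∑ c ∈ C, ∑ c' ∈ C, ZMod.stdAddChar (ξ * (c + v - c')) := by
      intro ξ
      rw [← Complex.mul_conj]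
      unfold fc
      rw [map_sum, sum_mul_sum, sum_mul]
      refine sum_congr rfl fun c _ => ?_
      rw [sum_mul]
      refine sum_congr rfl fun c' _ => ?_
      rw [← AddChar.map_neg_eq_conj, ← AddChar.map_add_eq_mul, ← AddChar.map_add_eq_mul]
      congr 1; ring
    simp_rw [h1]
    rw [sum_comm]
    have h2 : ∀ c ∈ C, (∑ ξ : ZMod p, ∑ c' ∈ C, (ZMod.stdAddChar (ξ * (c + v - c')) : ℂ))
        = p * (if c + v ∈ C then 1 else 0) := by
      intro c _
      rw [sum_comm]
      have h3 : ∀ c' ∈ C, (∑ ξ : ZMod p, (ZMod.stdAddChar (ξ * (c + v - c')) : ℂ))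
          = if c + v = c' then (p : ℂ) else 0 := by
        intro c' _
        rw [AddChar.sum_mulShift _ (ZMod.isPrimitive_stdAddChar p)]
        simp [sub_eq_zero, ZMod.card]
      rw [sum_congr rfl h3]
      simp
    rw [sum_congr rfl h2, ← mul_sum]
    congr 1
    rw [card_filter]; push_cast; rfl
  have := congrArg Complex.re key
  rw [Complex.re_sum] at this
  simpa using this

lemma fourierF (C V : Finset (ZMod p)) (R : ℕ) (hC : 0 < C.card) (h2 : 2 * C.card ≤ p)
    (hV : ∀ v ∈ V, nn C v ≤ R) : ∃ ξ : ZMod p, ξ ≠ 0 ∧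
      (V.card : ℝ) * (1 - 2 * R / C.card) ≤ ∑ v ∈ V, (ZMod.stdAddChar (ξ * v) : ℂ).re := by
  by_contra! hcon
  set b : ℝ := (C.card : ℝ) with hb
  have hb0 : 0 < b := by rw [hb]; exact_mod_cast hC
  have hp : 2 * b ≤ p := by rw [hb]; exact_mod_cast h2
  set K : ZMod p → ℝ := fun ξ => Complex.normSq (fc C ξ) with hK
  set T : ZMod p → ℝ := fun ξ => ∑ v ∈ V, (ZMod.stdAddChar (ξ * v) : ℂ).re with hT
  set τ : ℝ := (V.card : ℝ) * (1 - 2 * R / b) with hτ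
  have hK0 : K 0 = b ^ 2 := by
    simp only [hK, fc]; simp [Complex.normSq_apply]; ring
  have hT0 : T 0 = V.card := by simp [hT]
  have hKsum : ∑ ξ, K ξ = p * b := by
    have := fc_sum C 0
    simp at this
    simpa [hK] using this
  have hKT : (p : ℝ) * (V.card * (b - R)) ≤ ∑ ξ, K ξ * T ξ := by
    have : ∑ ξ, K ξ * T ξ = ∑ v ∈ V, (p : ℝ) * (C.filter (fun c => c + v ∈ C)).card := by
      simp_rw [hT, mul_sum]
      rw [sum_comm]
      exact sum_congr rfl fun v _ => fc_sum C v
    rw [this, ← mul_sum]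
    apply mul_le_mul_of_nonneg_left _ (by positivity)
    rw [← nsmul_eq_mul]
    apply card_nsmul_le_sum
    intro v hv
    have h1 := nn_add_card C v
    have h2 : nn C v ≤ R := hV v hv
    have h3 : ((C.filter (fun c => c + v ∈ C)).card : ℝ) + nn C v = b := by rw [hb]; exact_mod_cast h1
    have h4 : (nn C v : ℝ) ≤ R := by exact_mod_cast h2
    linarith
  have hKnn : ∀ ξ, 0 ≤ K ξ := fun ξ => Complex.normSq_nonneg _
  rw [← add_sum_erase univ _ (mem_univ (0 : ZMod p))] at hKsum hKT
  have hS : ∑ ξ ∈ univ.erase (0 : ZMod p), K ξ = p * b - b ^ 2 := by linarith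
  have hpos : 0 < ∑ ξ ∈ univ.erase (0 : ZMod p), K ξ := by rw [hS]; nlinarith
  have hlt : ∑ ξ ∈ univ.erase (0 : ZMod p), K ξ * T ξ < ∑ ξ ∈ univ.erase (0 : ZMod p), K ξ * τ := by
    apply sum_lt_sum
    · intro ξ hξ
      exact mul_le_mul_of_nonneg_left (hcon ξ (ne_of_mem_erase hξ)).le (hKnn ξ)
    · obtain ⟨ξ, hξ, h⟩ := exists_lt_of_sum_lt (s := univ.erase (0 : ZMod p)) (f := fun _ => (0:ℝ)) (g := K)
        (by simpa using hpos)
      exact ⟨ξ, hξ, mul_lt_mul_of_pos_left (hcon ξ (ne_of_mem_erase hξ)) h⟩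
  rw [← sum_mul, hS] at hlt
  rw [hK0, hT0] at hKT
  have e1 : (p * b - b ^ 2) * τ = V.card * (p * b - b^2 - 2 * R * (p - b)) := by
    rw [hτ]; field_simp
  rw [e1] at hlt
  have hv : (0:ℝ) ≤ V.card := by positivity
  have hR : (0:ℝ) ≤ R := by positivity
  have : (0:ℝ) ≤ V.card * (R * (p - 2 * b)) := mul_nonneg hv (mul_nonneg hR (by linarith))
  nlinarith

lemma re_bound (x : ZMod p) : (ZMod.stdAddChar x : ℂ).re ≤ 1 - 8 * ((x.valMinAbs : ℝ) / p) ^ 2 := by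
  have hp0 : (0:ℝ) < p := by exact_mod_cast (Fact.out : p.Prime).pos
  have h1 : (ZMod.stdAddChar x : ℂ) = Complex.exp (((2 * Real.pi * (x.valMinAbs / p) : ℝ) : ℂ) * Complex.I) := by
    conv_lhs => rw [← ZMod.coe_valMinAbs x]
    rw [ZMod.stdAddChar_coe]
    congr 1; push_cast; ring
  rw [h1, Complex.exp_ofReal_mul_I_re]
  have h2 : |(2 * Real.pi * (x.valMinAbs / p) : ℝ)| ≤ Real.pi := by
    have h3 := ZMod.natAbs_valMinAbs_le x
    have h4 : (2:ℝ) * |(x.valMinAbs : ℝ)| ≤ p := by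
      have : 2 * x.valMinAbs.natAbs ≤ p := by omega
      have h5 : ((x.valMinAbs.natAbs : ℕ) : ℝ) = |(x.valMinAbs : ℝ)| := by
        rw [Nat.cast_natAbs]; simp
      rw [← h5]; exact_mod_cast this
    rw [abs_mul, abs_mul, abs_div, abs_of_pos Real.pi_pos, abs_of_pos hp0]
    have : |(x.valMinAbs : ℝ)| / p ≤ 1 / 2 := by rw [div_le_iff₀ hp0]; linarith
    have := mul_le_mul_of_nonneg_left this (show 0 ≤ 2 * Real.pi by positivity)
    simp only [abs_two]; linarith
  have := Real.cos_le_one_sub_mul_cos_sq h2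
  have e : 1 - 2 / Real.pi ^ 2 * (2 * Real.pi * (x.valMinAbs / p)) ^ 2 = 1 - 8 * ((x.valMinAbs : ℝ) / p) ^ 2 := by
    have := Real.pi_pos.ne'
    field_simp; ring
  linarith

/-- most of `V` is in a short arc after dilation -/
lemma rectify (C V : Finset (ZMod p)) (R : ℕ) (hC : 0 < C.card) (h2 : 2 * C.card ≤ p)
    (hV : ∀ v ∈ V, nn C v ≤ R) : ∃ ξ : ZMod p, ξ ≠ 0 ∧
      ((V.filter (fun v => p < 8 * (ξ * v).valMinAbs.natAbs)).card : ℝ) * C.card ≤ 16 * R * V.card := by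
  obtain ⟨ξ, h0, h⟩ := fourierF C V R hC h2 hV
  refine ⟨ξ, h0, ?_⟩
  have hp0 : (0:ℝ) < p := by exact_mod_cast (Fact.out : p.Prime).pos
  have hb0 : (0:ℝ) < C.card := by exact_mod_cast hC
  have h3 : ∑ v ∈ V, (ZMod.stdAddChar (ξ * v) : ℂ).re ≤
      ∑ v ∈ V, ((1:ℝ) - (1/8) * if p < 8 * (ξ * v).valMinAbs.natAbs then 1 else 0) := by
    apply sum_le_sum
    intro v _
    refine (re_bound _).trans ?_
    split_ifs with hif
    · have h5 : (((ξ * v).valMinAbs.natAbs : ℕ) : ℝ) = |((ξ * v).valMinAbs : ℝ)| := by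
        rw [Nat.cast_natAbs]; simp
      have h6 : (p:ℝ) < 8 * |((ξ * v).valMinAbs : ℝ)| := by rw [← h5]; exact_mod_cast hif
      have h7 : (1/8 : ℝ) ≤ |((ξ * v).valMinAbs : ℝ)| / p := by
        rw [le_div_iff₀ hp0]; linarith
      have h8 : (((ξ * v).valMinAbs : ℝ) / p) ^ 2 = (|((ξ * v).valMinAbs : ℝ)| / p) ^ 2 := by
        rw [div_pow, div_pow, sq_abs]
      rw [h8]; nlinarith
    · have := sq_nonneg (((ξ * v).valMinAbs : ℝ) / p); linarith
  rw [sum_sub_distrib, ← mul_sum] at h3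
  have h4 : (∑ v ∈ V, if p < 8 * (ξ * v).valMinAbs.natAbs then (1:ℝ) else 0) =
    (V.filter (fun v => p < 8 * (ξ * v).valMinAbs.natAbs)).card := by
    rw [card_filter]; push_cast; rfl
  rw [h4] at h3
  simp at h3
  have h5 := h.trans h3
  have e : (V.card : ℝ) * (1 - 2 * R / C.card) * C.card = V.card * C.card - 2 * R * V.card := by
    field_simp
  have := mul_le_mul_of_nonneg_right h5 hb0.le
  rw [e] at this
  nlinarith
end fourier


lemma small_doubling_mul {G : Type*} [CommGroup G] [DecidableEq G] (A : Finset G)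
    (h : 2 * (A * A).card < 3 * A.card) :
    ∃ H : Subgroup G, Nat.card H = (A * A).card ∧ ∀ a ∈ A, ∀ b ∈ A, a⁻¹ * b ∈ H := by
  have h' : ((A * A).card : ℚ) < (3 / 2 : ℚ) * A.card := by
    have : (2:ℚ) * (A * A).card < 3 * A.card := by exact_mod_cast h
    linarith
  refine ⟨Finset.invMulSubgroup A h', ?_, ?_⟩
  · rw [← Finset.card_inv_mul_of_doubling_lt_three_halves h', ← Nat.card_eq_finsetCard]
    have := Finset.invMulSubgroup_eq_inv_mul A h'
    apply Nat.card_congr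
    apply Equiv.subtypeEquivRight
    intro x
    rw [← SetLike.mem_coe, this, ← Finset.mem_coe, Finset.coe_mul, Finset.coe_inv]
  · intro a ha b hb
    rw [← SetLike.mem_coe, Finset.invMulSubgroup_eq_inv_mul]
    exact Set.mul_mem_mul (Finset.mem_coe.2 (Finset.inv_mem_inv ha)) hb

lemma small_doubling_add {G : Type*} [AddCommGroup G] [DecidableEq G] (A : Finset G)
    (h : 2 * (A + A).card < 3 * A.card) :
    ∀ a ∈ A, ∀ b ∈ A, (A + A).card • (b - a) = 0 ∧ (A+A).card ∣ Nat.card G := by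
  classical
  set e : G → Multiplicative G := fun x => Multiplicative.ofAdd x with he
  have hinj : Function.Injective e := Multiplicative.ofAdd.injective
  have h2 : (A.image e * A.image e) = (A + A).image e := by
    ext z
    simp only [mem_mul, mem_image, mem_add]
    constructor
    · rintro ⟨_, ⟨a, ha, rfl⟩, _, ⟨b, hb, rfl⟩, rfl⟩
      exact ⟨a + b, ⟨a, ha, b, hb, rfl⟩, rfl⟩
    · rintro ⟨_, ⟨a, ha, b, hb, rfl⟩, rfl⟩
      exact ⟨_, ⟨a, ha, rfl⟩, _, ⟨b, hb, rfl⟩, rfl⟩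
  have h3 : (A.image e * A.image e).card = (A + A).card := by rw [h2, card_image_of_injective _ hinj]
  obtain ⟨H, h1, hH⟩ := small_doubling_mul (A.image e) (by rw [h3, card_image_of_injective _ hinj]; exact h)
  rw [h3] at h1
  intro a ha b hb
  have h3 := hH _ (mem_image_of_mem e ha) _ (mem_image_of_mem e hb)
  constructor
  · have := pow_card_eq_one' (x := (⟨_, h3⟩ : H))
    rw [h1] at this
    have h4 := congrArg (fun x : H => (Multiplicative.toAdd (x : Multiplicative G))) this
    have h5 : (A + A).card • (-a + b) = 0 := h4
    rw [← h5]; congr 1; abel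
  · rw [← h1]; exact Subgroup.card_subgroup_dvd_card H

lemma lemZ (A : Finset ℤ) (h2 : 2 ≤ A.card) (h : 2 * (A + A).card < 5 * (A.card - 1)) :
    ∃ (a d : ℤ) (q : ℕ), q + (A.card - 1) ≤ (A + A).card ∧ ∀ x ∈ A, ∃ i : ℕ, i ≤ q ∧ x = a + i * d := by
  have hne : A.Nonempty := card_pos.1 (by omega)
  set m0 := A.min' hne with hm0
  set M1 := A.max' hne with hM1
  have hm0A : m0 ∈ A := min'_mem _ _
  have hM1A : M1 ∈ A := max'_mem _ _
  have hlt : m0 < M1 := min'_lt_max'_of_card A (by omega)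
  have hlo : ∀ x ∈ A, m0 ≤ x := fun x hx => min'_le _ _ hx
  have hhi : ∀ x ∈ A, x ≤ M1 := fun x hx => le_max' _ _ hx
  obtain ⟨N, hN⟩ : ∃ N : ℕ, (N : ℤ) = M1 - m0 := ⟨(M1 - m0).toNat, by omega⟩
  have hNpos : 0 < N := by omega
  have : NeZero N := ⟨by omega⟩
  set π : ℤ → ZMod N := fun x => ((x - m0 : ℤ) : ZMod N) with hπ
  set Ab := A.image π with hAb
  have hcard : A.card - 1 ≤ Ab.card := by
    rw [← card_erase_of_mem hM1A]
    apply card_le_card_of_injOn π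
    · intro x hx; exact mem_image_of_mem _ (mem_of_mem_erase hx)
    · intro x hx y hy hxy
      simp only [coe_erase, Set.mem_sdiff, mem_coe, Set.mem_singleton_iff] at hx hy
      have h3 : ((x - m0 : ℤ) : ZMod N) = ((y - m0 : ℤ) : ZMod N) := hxy
      rw [ZMod.intCast_eq_intCast_iff] at h3
      have h4 := h3.eq
      have a1 := hlo x hx.1; have a2 := hhi x hx.1
      have a3 := hlo y hy.1; have a4 := hhi y hy.1
      have a5 : x ≠ M1 := hx.2
      have a6 : y ≠ M1 := hy.2
      rw [Int.emod_eq_of_lt (by omega) (by omega), Int.emod_eq_of_lt (by omega) (by omega)] at h4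
      omega
  have hNz : ((M1 - m0 : ℤ) : ZMod N) = 0 := by rw [← hN]; simp
  have hsum : (Ab + Ab).card + (A.card - 1) ≤ (A + A).card := by
    set T := (A.erase M1).image (fun x => x + M1) with hT
    have hTc : T.card = A.card - 1 := by
      rw [hT, card_image_of_injective _ (add_left_injective M1), card_erase_of_mem hM1A]
    have hTs : T ⊆ A + A := by
      intro x hx
      obtain ⟨y, hy, rfl⟩ := mem_image.1 hx
      exact add_mem_add (mem_of_mem_erase hy) hM1A
    have h3 : Ab + Ab ⊆ ((A + A) \ T).image (fun x => ((x - 2 * m0 : ℤ) : ZMod N)) := by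
      intro z hz
      obtain ⟨u, hu, v, hv, rfl⟩ := mem_add.1 hz
      obtain ⟨x, hx, rfl⟩ := mem_image.1 hu
      obtain ⟨y, hy, rfl⟩ := mem_image.1 hv
      rw [mem_image]
      by_cases hT' : x + y ∈ T
      · obtain ⟨w, hw, hw'⟩ := mem_image.1 hT'
        refine ⟨w + m0, ?_, ?_⟩
        · rw [mem_sdiff]
          refine ⟨add_mem_add (mem_of_mem_erase hw) hm0A, ?_⟩
          intro h5
          obtain ⟨w', hw', e⟩ := mem_image.1 h5
          have := hlo w' (mem_of_mem_erase hw')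
          have := hhi w (mem_of_mem_erase hw)
          have := ne_of_mem_erase hw
          omega
        · simp only [hπ]
          rw [← Int.cast_add]
          have : x - m0 + (y - m0) = (w + m0 - 2 * m0) + (M1 - m0) := by omega
          rw [this, Int.cast_add _ (M1 - m0), hNz, add_zero]
      · refine ⟨x + y, mem_sdiff.2 ⟨add_mem_add hx hy, hT'⟩, ?_⟩
        simp only [hπ]
        rw [← Int.cast_add]; congr 1; ring
    have h4 := (card_le_card h3).trans card_image_le
    have h5 := card_sdiff_add_card_eq_card hTs
    omega
  have hdb : 2 * (Ab + Ab).card < 3 * Ab.card := by omega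
  have hkey := small_doubling_add Ab hdb
  set q := (Ab + Ab).card with hq
  have h0 : π m0 ∈ Ab := mem_image_of_mem _ hm0A
  have hqN : q ∣ N := by
    have := (hkey _ h0 _ h0).2
    simpa using this
  obtain ⟨d, hd⟩ := hqN
  have hdpos : 0 < d := by rcases Nat.eq_zero_or_pos d with h | h; · subst h; simp at hd; omega
                           · exact h
  have hqpos : 0 < q := by rcases Nat.eq_zero_or_pos q with h | h; · rw [h] at hd; simp at hd; omega
                           · exact h
  refine ⟨m0, d, q, hsum, ?_⟩
  intro x hx
  have h6 := (hkey _ h0 _ (mem_image_of_mem π hx)).1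
  have h7 : ((q * (x - m0) : ℤ) : ZMod N) = 0 := by
    rw [← h6]; simp [hπ]
  rw [ZMod.intCast_zmod_eq_zero_iff_dvd, hd] at h7
  push_cast at h7
  have h8 : (d : ℤ) ∣ x - m0 := by
    exact Int.dvd_of_mul_dvd_mul_left (by positivity) h7
  obtain ⟨k, hk⟩ := h8
  have a1 := hlo x hx
  have a2 := hhi x hx
  have hk0 : 0 ≤ k := by
    by_contra hneg
    push Not at hneg
    have : (d:ℤ) * k < 0 := mul_neg_of_pos_of_neg (by exact_mod_cast hdpos) hneg
    omega
  have hkq : k ≤ q := by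
    have : (d:ℤ) * k ≤ d * q := by
      rw [← hk]
      have : (N:ℤ) = q * d := by exact_mod_cast hd
      rw [mul_comm, ← this]; omega
    exact le_of_mul_le_mul_left this (by exact_mod_cast hdpos)
  refine ⟨k.toNat, by omega, ?_⟩
  rw [Int.toNat_of_nonneg hk0, mul_comm]; omega

section lemmaM
variable {p : ℕ} [Fact p.Prime]

lemma gap (T : Finset (ZMod p)) (b d : ZMod p) (q x : ℕ)
    (hT : ∀ y ∈ T, ∃ i : ℕ, i ≤ q ∧ y = b + i * d) (h : q + 1 + x < 2 * T.card) :
    ∃ y ∈ T, ∃ y' ∈ T, y - y' = x * d := by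
  set I := (range (q+1)).filter (fun i : ℕ => b + (i : ZMod p) * d ∈ T) with hI
  have h1 : T.card ≤ I.card := by
    have : T ⊆ I.image (fun i : ℕ => b + (i : ZMod p) * d) := by
      intro y hy
      obtain ⟨i, hi, rfl⟩ := hT y hy
      exact mem_image.2 ⟨i, by simp [hI, hy]; omega, rfl⟩
    exact (card_le_card this).trans card_image_le
  have h2 : (I.image (fun i => i + x)).card = I.card := card_image_of_injective _ (add_left_injective x)
  have h3 : (I ∪ I.image (fun i => i + x)).card ≤ q + 1 + x := by
    rw [← card_range (q + 1 + x)]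
    apply card_le_card
    intro i
    simp only [hI, mem_union, mem_image, mem_filter, mem_range]
    rintro (h | ⟨j, h, rfl⟩) <;> omega
  have h4 := card_union_add_card_inter I (I.image (fun i => i + x))
  have h5 : 0 < (I ∩ I.image (fun i => i + x)).card := by omega
  obtain ⟨i, hi⟩ := card_pos.1 h5
  simp only [hI, mem_inter, mem_image, mem_filter, mem_range] at hi
  obtain ⟨⟨_, h6⟩, ⟨j, ⟨_, h7⟩, h8⟩⟩ := hi
  refine ⟨_, h6, _, h7, ?_⟩
  rw [← h8]; push_cast; ring

lemma lemM (C W : Finset (ZMod p)) (r n : ℕ) (hr : 0 < r)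
    (hn : n * r ≤ C.card) (hn' : C.card < (n+1) * r) (h2 : 2 * C.card ≤ p) (hW : W.Nonempty)
    (h : ∀ w ∈ W, nn C w ≤ r) (hn0 : 10 ^ 7 ≤ n)
    (hc : (C.card : ℝ) * (2 * r - ((W.card : ℝ) - 1)) ≤ 2 * (r:ℝ) ^ 2) :
    ∃ d : ZMod p, d ≠ 0 ∧ ∀ x : ℕ, x ≤ 1600 * r → nn C (x * d) ≤ 2000 * r := by
  obtain ⟨hb1, hb2⟩ := lemMu C W r n hr hn hn' h2 hW h (by omega) hc
  replace hb1 : (ball C (2000 * r)).card ≤ 4050 * r := by exact_mod_cast hb1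
  replace hb2 : 1999 * r ≤ (ball C (1000 * r)).card := by exact_mod_cast hb2
  have hCr : 10 ^ 7 * r ≤ C.card := (Nat.mul_le_mul_right r hn0).trans hn
  set V := ball C (1000 * r) with hV
  have hVsub : V ⊆ ball C (2000 * r) := by
    intro v hv; rw [hV, mem_ball] at hv; rw [mem_ball]; omega
  have hVc : V.card ≤ 4050 * r := (card_le_card hVsub).trans hb1
  obtain ⟨ξ, hξ, hbad⟩ := rectify C V (1000 * r) (by omega) h2 (fun v hv => mem_ball.1 hv)
  have hbad' : (V.filter (fun v => p < 8 * (ξ * v).valMinAbs.natAbs)).card * C.card ≤ 16 * (1000 * r) * V.card := by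
    exact_mod_cast hbad
  set bad := (V.filter (fun v => p < 8 * (ξ * v).valMinAbs.natAbs)).card with hbd
  have hbadc : bad ≤ 9 * r := by
    by_contra hcon
    push Not at hcon
    have e1 : 9 * r * (10 ^ 7 * r) ≤ bad * C.card := Nat.mul_le_mul hcon.le hCr
    have e2 : 16 * (1000 * r) * V.card ≤ 16 * (1000 * r) * (4050 * r) := Nat.mul_le_mul_left _ hVc
    have : 0 < r * r := by positivity
    nlinarith
  set V1 := V.filter (fun v => ¬ p < 8 * (ξ * v).valMinAbs.natAbs) with hV1
  have hV1c : 1990 * r ≤ V1.card := by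
    have : bad + V1.card = V.card := card_filter_add_card_filter_not _
    omega
  have hV1V : ∀ v ∈ V1, nn C v ≤ 1000 * r := fun v hv => mem_ball.1 (mem_filter.1 hv).1
  have hV1s : ∀ v ∈ V1, 8 * (ξ * v).valMinAbs.natAbs ≤ p := fun v hv => not_lt.1 (mem_filter.1 hv).2
  set L := V1.image (fun v => (ξ * v).valMinAbs) with hL
  have hinj : Function.Injective (fun v : ZMod p => (ξ * v).valMinAbs) := by
    intro v v' h
    have : ξ * v = ξ * v' := by
      have := congrArg (fun z : ℤ => (z : ZMod p)) h
      simpa using this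
    exact mul_left_cancel₀ hξ this
  have hLc : L.card = V1.card := card_image_of_injective _ hinj
  have hppos : 0 < p := (Fact.out : p.Prime).pos
  have hLL : (L + L).card ≤ 4050 * r := by
    refine le_trans ?_ hb1
    apply card_le_card_of_injOn (fun s : ℤ => ξ⁻¹ * (s : ZMod p))
    · intro s hs
      obtain ⟨u, hu, u', hu', rfl⟩ := mem_add.1 (mem_coe.1 hs)
      obtain ⟨v, hv, rfl⟩ := mem_image.1 hu
      obtain ⟨v', hv', rfl⟩ := mem_image.1 hu'
      rw [mem_coe, mem_ball]
      have : ξ⁻¹ * (((ξ * v).valMinAbs + (ξ * v').valMinAbs : ℤ) : ZMod p) = v + v' := by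
        push_cast
        field_simp
      show nn C (ξ⁻¹ * (((ξ * v).valMinAbs + (ξ * v').valMinAbs : ℤ) : ZMod p)) ≤ _
      rw [this]
      have := nn_add C v v'
      have := hV1V v hv
      have := hV1V v' hv'
      omega
    · intro s hs s' hs' hss
      have e : (s : ZMod p) = (s' : ZMod p) := mul_left_cancel₀ (inv_ne_zero hξ) hss
      obtain ⟨u, hu, u', hu', rfl⟩ := mem_add.1 (mem_coe.1 hs)
      obtain ⟨v, hv, rfl⟩ := mem_image.1 hu
      obtain ⟨v', hv', rfl⟩ := mem_image.1 hu'
      obtain ⟨u, hu, u', hu', rfl⟩ := mem_add.1 (mem_coe.1 hs')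
      obtain ⟨w, hw, rfl⟩ := mem_image.1 hu
      obtain ⟨w', hw', rfl⟩ := mem_image.1 hu'
      have a1 := hV1s v hv
      have a2 := hV1s v' hv'
      have a3 := hV1s w hw
      have a4 := hV1s w' hw'
      rw [ZMod.intCast_eq_intCast_iff_dvd_sub] at e
      have := Int.eq_zero_of_abs_lt_dvd e (by rw [abs_lt]; constructor <;> omega)
      omega
  obtain ⟨a, d, q, hq, hAP⟩ := lemZ L (by omega) (by omega)
  have hT : ∀ y ∈ V1, ∃ i : ℕ, i ≤ q ∧ y = ξ⁻¹ * (a : ZMod p) + i * (ξ⁻¹ * (d : ZMod p)) := by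
    intro y hy
    obtain ⟨i, hi, e⟩ := hAP _ (mem_image_of_mem _ hy)
    refine ⟨i, hi, ?_⟩
    have e2 := congrArg (fun z : ℤ => (z : ZMod p)) e
    simp only [ZMod.coe_valMinAbs] at e2
    push_cast at e2
    have : y = ξ⁻¹ * (ξ * y) := by field_simp
    rw [this, e2]; ring
  refine ⟨ξ⁻¹ * (d : ZMod p), ?_, ?_⟩
  · intro h0
    have : 1 < V1.card := by omega
    obtain ⟨y, hy, y', hy', hne⟩ := one_lt_card.1 this
    obtain ⟨i, _, e⟩ := hT y hy
    obtain ⟨i', _, e'⟩ := hT y' hy'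
    apply hne; rw [e, e', h0]; simp
  · intro x hx
    obtain ⟨y, hy, y', hy', e⟩ := gap V1 _ _ q x hT (by omega)
    rw [← e]
    have := nn_sub C y y'
    have := hV1V y hy
    have := hV1V y' hy'
    omega
end lemmaM

section lemmaT
variable {p : ℕ} [Fact p.Prime]

lemma exists_coord (a d y : ZMod p) (hd : d ≠ 0) : ∃ i : ℕ, i < p ∧ y = a + i * d := by
  refine ⟨((y - a) / d).val, ZMod.val_lt _, ?_⟩
  rw [ZMod.natCast_val, ZMod.cast_id]; field_simp; ring

lemma one_run (E : Finset (ZMod p)) (d : ZMod p) (hd : d ≠ 0) (h1 : E.Nonempty) (h2 : E ≠ univ)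
    (h3 : (univ.filter (fun y => y ∉ E ∧ y + d ∈ E)).card ≤ 1) :
    ∃ (a : ZMod p) (len : ℕ), E = zmodAP p a d len := by
  obtain ⟨z, hz⟩ : ∃ z, z ∉ E := by
    by_contra hcon; push Not at hcon; exact h2 (eq_univ_iff_forall.2 hcon)
  obtain ⟨y0, hy0, hy1⟩ : ∃ y, y ∉ E ∧ y + d ∈ E := by
    by_contra hcon
    push Not at hcon
    have : ∀ k : ℕ, z + k * d ∉ E := by
      intro k
      induction k with
      | zero => simpa using hz
      | succ k ih => have := hcon _ ih; push_cast; rwa [add_mul, one_mul, ← add_assoc]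
    obtain ⟨y, hy⟩ := h1
    obtain ⟨i, _, rfl⟩ := exists_coord z d y hd
    exact this i hy
  have huniq : ∀ y, y ∉ E → y + d ∈ E → y = y0 := by
    intro y hy hy'
    exact card_le_one.1 h3 y (by simp [hy, hy']) y0 (by simp [hy0, hy1])
  set a := y0 + d with ha
  have hex : ∃ k : ℕ, a + (k : ZMod p) * d ∉ E := by
    obtain ⟨i, _, rfl⟩ := exists_coord a d z hd
    exact ⟨i, hz⟩
  classical
  set len := Nat.find hex with hlen
  have hin : ∀ i < len, a + (i : ZMod p) * d ∈ E := fun i hi => not_not.1 (Nat.find_min hex hi)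
  have hout : ∀ i, len ≤ i → i < p → a + (i : ZMod p) * d ∉ E := by
    intro i hi
    induction i, hi using Nat.le_induction with
    | base => intro _; exact Nat.find_spec hex
    | succ i hi ih =>
      intro hip hmem
      have h4 := ih (by omega)
      have h5 := huniq _ h4 (by push_cast at hmem; rwa [add_assoc, ← add_one_mul])
      have h6 : ((i + 1 : ℕ) : ZMod p) * d = 0 := by
        push_cast
        have : y0 + d + i * d = y0 + 0 := by rw [add_zero]; exact h5
        rw [add_assoc] at this
        have := add_left_cancel this
        rw [← this]; ring
      rcases mul_eq_zero.1 h6 with h7 | h7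
      · rw [ZMod.natCast_eq_zero_iff] at h7
        exact absurd (Nat.le_of_dvd (by omega) h7) (by omega)
      · exact hd h7
  refine ⟨a, len, ?_⟩
  ext y
  unfold zmodAP
  rw [mem_image]
  constructor
  · intro hy
    obtain ⟨i, hi, rfl⟩ := exists_coord a d y hd
    refine ⟨i, ?_, rfl⟩
    rw [mem_range]
    by_contra hcon
    exact hout i (by omega) hi hy
  · rintro ⟨i, hi, rfl⟩
    exact hin i (mem_range.1 hi)

lemma nn_compl_filter (C : Finset (ZMod p)) (x : ZMod p) :
    (univ.filter (fun y => y ∉ C ∧ y + x ∈ C)).card = nn C x := by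
  rw [← nn_compl C x, nn]
  congr 1; ext y; simp

lemma lemT (C : Finset (ZMod p)) (d : ZMod p) (hd : d ≠ 0) (l : ℕ) (hl : 0 < l)
    (h : ∀ x : ℕ, x ≤ 8 * l → nn C (x * d) ≤ 10 * l)
    (h1 : 160 * l < C.card) (h2 : 160 * l + C.card < p) :
    ∃ (a : ZMod p) (len : ℕ), (symmDiff C (zmodAP p a d len)).card ≤ 160 * l := by
  classical
  set hh : ZMod p → ℕ := fun y => ((range (8 * l)).filter (fun i : ℕ => y + (i : ZMod p) * d ∈ C)).card with hhd
  set E : ℕ → Finset (ZMod p) := fun θ => univ.filter (fun y => θ ≤ hh y) with hE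
  -- closeness
  have hclose : ∀ θ, l ≤ θ → θ ≤ 7 * l → (symmDiff C (E θ)).card ≤ 160 * l := by
    intro θ h3 h4
    have key : l * (symmDiff C (E θ)).card ≤ ∑ i ∈ range (8 * l), 2 * nn C (i * d) := by
      have e1 : ∀ i ∈ range (8 * l), 2 * nn C ((i : ZMod p) * d) =
          (univ.filter (fun y : ZMod p => ¬ (y ∈ C ↔ y + (i : ZMod p) * d ∈ C))).card := by
        intro i _
        rw [two_mul]
        nth_rewrite 1 [← nn_compl_filter]
        rw [nn, ← card_union_of_disjoint]
        · congr 1; ext y; simp only [mem_union, mem_filter, mem_univ, true_and]; tauto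
        · rw [disjoint_left]; intro y; simp only [mem_filter, mem_univ, true_and]; tauto
      rw [sum_congr rfl e1]
      simp_rw [card_filter]
      rw [sum_comm]
      have e2 : ∀ y ∈ symmDiff C (E θ), l ≤ ∑ i ∈ range (8 * l), (if ¬ (y ∈ C ↔ y + (i : ZMod p) * d ∈ C) then 1 else 0) := by
        intro y hy
        rw [← card_filter]
        have hsum := card_filter_add_card_filter_not (s := range (8 * l)) (fun i : ℕ => y + (i : ZMod p) * d ∈ C)
        rw [card_range] at hsum
        rw [mem_symmDiff] at hy
        rcases hy with ⟨hy1, hy2⟩ | ⟨hy1, hy2⟩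
        · simp only [hE, mem_filter, mem_univ, true_and, hhd, not_le] at hy2
          have : (range (8 * l)).filter (fun i : ℕ => ¬ (y ∈ C ↔ y + (i : ZMod p) * d ∈ C)) =
            (range (8 * l)).filter (fun i : ℕ => ¬ (y + (i : ZMod p) * d ∈ C)) := by
            apply filter_congr; intro i _; tauto
          rw [this]; omega
        · simp only [hE, mem_filter, mem_univ, true_and, hhd] at hy1
          have : (range (8 * l)).filter (fun i : ℕ => ¬ (y ∈ C ↔ y + (i : ZMod p) * d ∈ C)) =
            (range (8 * l)).filter (fun i : ℕ => (y + (i : ZMod p) * d ∈ C)) := by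
            apply filter_congr; intro i _; tauto
          rw [this]; omega
      calc l * (symmDiff C (E θ)).card = ∑ y ∈ symmDiff C (E θ), l := by simp [mul_comm]
        _ ≤ _ := sum_le_sum e2
        _ ≤ _ := sum_le_sum_of_subset (subset_univ _)
    have key2 : ∑ i ∈ range (8 * l), 2 * nn C ((i : ZMod p) * d) ≤ ∑ i ∈ range (8 * l), 20 * l := by
      apply sum_le_sum
      intro i hi
      have := h i (mem_range.1 hi).le
      omega
    rw [sum_const, card_range, smul_eq_mul] at key2
    have : l * (symmDiff C (E θ)).card ≤ l * (160 * l) := by nlinarith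
    exact Nat.le_of_mul_le_mul_left this hl
  -- step
  have hstep : ∀ y, hh (y + d) + (if y ∈ C then 1 else 0) =
      hh y + (if y + ((8 * l : ℕ) : ZMod p) * d ∈ C then 1 else 0) := by
    intro y
    simp only [hhd, card_filter]
    have := sum_range_succ' (fun i : ℕ => if y + (i : ZMod p) * d ∈ C then 1 else 0) (8 * l)
    rw [sum_range_succ] at this
    simp only [Nat.cast_zero, zero_mul, add_zero] at this
    rw [this]
    congr 1
    apply sum_congr rfl
    intro i _
    have : y + d + (i : ZMod p) * d = y + ((i + 1 : ℕ) : ZMod p) * d := by push_cast; ring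
    rw [this]
  have hup : ∑ θ ∈ Icc l (7 * l), (univ.filter (fun y => y ∉ E θ ∧ y + d ∈ E θ)).card ≤ 10 * l := by
    refine le_trans ?_ (h (8 * l) le_rfl)
    rw [← nn_compl_filter]
    simp_rw [card_filter]
    rw [sum_comm]
    apply sum_le_sum
    intro y _
    rw [← card_filter]
    have hs := hstep y
    split_ifs with hif
    · rw [card_le_one]
      intro θ hθ θ' hθ'
      simp only [hE, mem_filter, mem_univ, true_and] at hθ hθ'
      split_ifs at hs <;> omega
    · rw [Nat.le_zero, card_eq_zero, filter_eq_empty_iff]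
      intro θ _ hcon
      simp only [hE, mem_filter, mem_univ, true_and] at hcon
      split_ifs at hs <;> first | omega | tauto
  obtain ⟨θ, hθ, hθ1⟩ : ∃ θ ∈ Icc l (7 * l), (univ.filter (fun y => y ∉ E θ ∧ y + d ∈ E θ)).card ≤ 1 := by
    by_contra! hcon
    have := card_nsmul_le_sum _ _ 2 (fun θ hθ => hcon θ hθ)
    rw [Nat.card_Icc, smul_eq_mul] at this
    omega
  rw [mem_Icc] at hθ
  have hc := hclose θ hθ.1 hθ.2
  obtain ⟨a, len, hAP⟩ := one_run (E θ) d hd (by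
    by_contra hne
    rw [not_nonempty_iff_eq_empty] at hne
    rw [hne] at hc
    have : symmDiff C ∅ = C := by ext; simp [mem_symmDiff]
    rw [this] at hc; omega) (by
    intro hne
    rw [hne] at hc
    have : symmDiff C univ = Cᶜ := by ext; simp [mem_symmDiff]
    rw [this, card_compl, ZMod.card] at hc; omega) hθ1
  exact ⟨a, len, by rw [← hAP]; exact hc⟩
end lemmaT

section shrink
variable {p : ℕ} [Fact p.Prime]

lemma lemMT (C W : Finset (ZMod p)) (r : ℕ) (hr : 0 < r)
    (hn : 10 ^ 7 * r ≤ C.card) (h2 : 2 * C.card ≤ p) (hW : W.Nonempty)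
    (h : ∀ w ∈ W, nn C w ≤ r)
    (hc : (C.card : ℝ) * (2 * r - ((W.card : ℝ) - 1)) ≤ 2 * (r:ℝ) ^ 2) :
    ∃ (d a : ZMod p) (len : ℕ), d ≠ 0 ∧ (symmDiff C (zmodAP p a d len)).card ≤ 32000 * r := by
  obtain ⟨d, hd, h3⟩ := lemM C W r (C.card / r) hr (Nat.div_mul_le_self _ _)
    (by rw [mul_comm]; exact Nat.lt_mul_div_succ _ hr) h2 hW h ((Nat.le_div_iff_mul_le hr).2 hn) hc
  obtain ⟨a, len, h4⟩ := lemT C d hd (200 * r) (by omega)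
    (fun x hx => (h3 x (by omega)).trans (by omega)) (by omega) (by omega)
  exact ⟨d, a, len, hd, by omega⟩

lemma gg_split (t : ℕ) (X B : Finset (ZMod p)) :
    gg t X B = t * (univ.filter (fun z => t ≤ rep X B z)).card
      + ∑ z ∈ univ.filter (fun z => ¬ t ≤ rep X B z), rep X B z := by
  unfold gg
  rw [← sum_filter_add_sum_filter_not univ (fun z => t ≤ rep X B z)]
  congr 1
  · rw [mul_comm, ← smul_eq_mul, ← sum_const]
    apply sum_congr rfl; intro z hz
    exact min_eq_right (mem_filter.1 hz).2
  · apply sum_congr rfl; intro z hz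
    exact min_eq_left (not_le.1 (mem_filter.1 hz).2).le

lemma nn_eq_sdiff (B : Finset (ZMod p)) (x x' : ZMod p) : nn B (x - x') = (tr B x \ tr B x').card := by
  unfold nn
  apply card_bij (fun b _ => b + x)
  · intro b hb
    simp only [mem_filter, mem_sdiff, mem_tr] at hb ⊢
    refine ⟨by simpa using hb.1, ?_⟩
    have := hb.2
    rwa [show b + x - x' = b + (x - x') by ring]
  · intro a _ b _ h; exact add_left_injective x h
  · intro y hy
    simp only [mem_filter, mem_sdiff, mem_tr] at hy ⊢
    exact ⟨y - x, ⟨hy.1, by rw [show y - x + (x - x') = y - x' by ring]; exact hy.2⟩, by ring⟩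

lemma good (t : ℕ) (ht : 0 < t) (X B : Finset (ZMod p)) (D : ℝ) (hD : 0 < D)
    (h : (gg t X B : ℝ) ≤ t * (X.card + B.card + D)) :
    ∃ X' ⊆ X, ((X.card : ℝ) - X'.card) * D ≤ t * (X.card + B.card + D) ∧
      ∀ x ∈ X', ∀ x' ∈ X', (nn B (x - x') : ℝ) ≤ X.card + 3 * D := by
  set S := univ.filter (fun z => t ≤ rep X B z) with hS
  have htR : (0:ℝ) < t := by exact_mod_cast ht
  have hsplit : (gg t X B : ℝ) = t * S.card + ((∑ z ∈ univ.filter (fun z => ¬ t ≤ rep X B z), rep X B z : ℕ) : ℝ) := by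
    rw [gg_split]; push_cast; rfl
  have hSc : (S.card : ℝ) ≤ X.card + B.card + D := by
    have : (t:ℝ) * S.card ≤ t * (X.card + B.card + D) := by
      have : (0:ℝ) ≤ ((∑ z ∈ univ.filter (fun z => ¬ t ≤ rep X B z), rep X B z : ℕ) : ℝ) := by positivity
      linarith
    exact le_of_mul_le_mul_left this htR
  have hsw : (∑ z ∈ univ.filter (fun z => ¬ t ≤ rep X B z), rep X B z) = ∑ x ∈ X, (tr B x \ S).card := by
    unfold rep
    simp_rw [card_filter]
    rw [sum_comm]
    apply sum_congr rfl
    intro x _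
    rw [← card_filter, filter_filter]
    congr 1; ext z
    simp only [hS, mem_filter, mem_univ, true_and, mem_sdiff, mem_tr, rep, card_filter]
    tauto
  set X' := X.filter (fun x => ((tr B x \ S).card : ℝ) ≤ D) with hX'
  refine ⟨X', filter_subset _ _, ?_, ?_⟩
  · have h1 : (X.card : ℝ) - X'.card = (X.filter (fun x => ¬ ((tr B x \ S).card : ℝ) ≤ D)).card := by
      have := card_filter_add_card_filter_not (s := X) (fun x => ((tr B x \ S).card : ℝ) ≤ D)
      rw [← this]; push_cast; ring
    rw [h1]
    have h2 : ((X.filter (fun x => ¬ ((tr B x \ S).card : ℝ) ≤ D)).card : ℝ) * D ≤ ∑ x ∈ X, ((tr B x \ S).card : ℝ) := by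
      rw [← nsmul_eq_mul]
      refine (card_nsmul_le_sum _ _ _ (fun x hx => (not_le.1 (mem_filter.1 hx).2).le)).trans ?_
      exact sum_le_sum_of_subset_of_nonneg (filter_subset _ _) (fun _ _ _ => by positivity)
    rw [hsw] at hsplit
    push_cast at hsplit
    have : (0:ℝ) ≤ t * S.card := by positivity
    linarith
  · intro x hx x' hx'
    rw [nn_eq_sdiff]
    have e1 : ((tr B x \ S).card : ℝ) ≤ D := (mem_filter.1 hx).2
    have e2 : ((tr B x' \ S).card : ℝ) ≤ D := (mem_filter.1 hx').2
    have e3 : (tr B x \ tr B x').card ≤ (tr B x \ S).card + (S \ tr B x').card := by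
      refine (card_le_card ?_).trans (card_union_le _ _)
      intro z; simp only [mem_sdiff, mem_union]; tauto
    have e4 : (S \ tr B x').card + B.card = S.card + (tr B x' \ S).card := by
      have f1 := card_sdiff_add_card_inter S (tr B x')
      have f2 := card_sdiff_add_card_inter (tr B x') S
      rw [inter_comm, card_tr] at f2
      omega
    have e3' : ((tr B x \ tr B x').card : ℝ) ≤ (tr B x \ S).card + (S \ tr B x').card := by exact_mod_cast e3
    have e4' : ((S \ tr B x').card : ℝ) + B.card = S.card + (tr B x' \ S).card := by exact_mod_cast e4
    linarith

lemma sum_rep_sq (A X : Finset (ZMod p)) :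
    ∑ z, (rep A X z) ^ 2 = ∑ a ∈ A, ∑ a' ∈ A, (X ∩ tr X (a - a')).card := by
  have h1 : ∀ z, (rep A X z) ^ 2 = ∑ a ∈ A, ∑ a' ∈ A, if (z - a ∈ X ∧ z - a' ∈ X) then 1 else 0 := by
    intro z
    unfold rep
    rw [card_filter, sq, sum_mul_sum]
    apply sum_congr rfl; intro a _
    apply sum_congr rfl; intro a' _
    split_ifs <;> simp_all
  simp_rw [h1]
  rw [sum_comm]
  apply sum_congr rfl; intro a _
  rw [sum_comm]
  apply sum_congr rfl; intro a' _
  rw [← card_filter]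
  apply card_bij (fun z _ => z - a')
  · intro z hz
    simp only [mem_filter, mem_univ, true_and, mem_inter, mem_tr] at hz ⊢
    refine ⟨hz.2, ?_⟩
    rw [show z - a' - (a - a') = z - a by ring]; exact hz.1
  · intro x _ y _ h; simpa using h
  · intro y hy
    simp only [mem_filter, mem_univ, true_and, mem_inter, mem_tr] at hy ⊢
    refine ⟨y + a', ⟨?_, by simpa using hy.1⟩, by ring⟩
    have := hy.2
    rwa [show y + a' - a = y - (a - a') by ring]

lemma lemE (t : ℕ) (ht : 0 < t) (A X : Finset (ZMod p)) (Q : ℝ) (hQ : 0 < Q)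
    (h : (gg t A X : ℝ) ≤ t * Q) (h1 : t * Q ≤ A.card * X.card / 2) (h2 : 8 * Q < A.card * X.card) :
    ∃ τ : ZMod p, τ ≠ 0 ∧ (X.card : ℝ) ^ 2 ≤ 8 * Q * (X ∩ tr X τ).card := by
  by_contra! hcon
  set S := univ.filter (fun z => t ≤ rep A X z) with hS
  have htR : (0:ℝ) < t := by exact_mod_cast ht
  set R := (∑ z ∈ univ.filter (fun z => ¬ t ≤ rep A X z), rep A X z) with hR
  have hsplit : (gg t A X : ℝ) = t * S.card + (R : ℝ) := by
    rw [gg_split, hR]; push_cast; rfl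
  have hR0 : (0:ℝ) ≤ R := by positivity
  have hS0 : (0:ℝ) ≤ t * S.card := by positivity
  have hSc : (S.card : ℝ) ≤ Q := by
    have : (t:ℝ) * S.card ≤ t * Q := by linarith
    exact le_of_mul_le_mul_left this htR
  have hsumS : (A.card : ℝ) * X.card / 2 ≤ ∑ z ∈ S, (rep A X z : ℝ) := by
    have e := sum_rep A X
    rw [← sum_filter_add_sum_filter_not univ (fun z => t ≤ rep A X z)] at e
    have e' : (∑ z ∈ S, (rep A X z : ℝ)) + R = A.card * X.card := by
      have : ((∑ z ∈ S, rep A X z : ℕ) : ℝ) + (R : ℝ) = ((A.card * X.card : ℕ) : ℝ) := by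
        rw [← e, hR]; push_cast; rfl
      push_cast at this; exact this
    linarith
  have hCS := sq_sum_le_card_mul_sum_sq (s := S) (f := fun z => (rep A X z : ℝ))
  have hsq : ∑ z ∈ S, (rep A X z : ℝ) ^ 2 ≤ ∑ a ∈ A, ∑ a' ∈ A, ((X ∩ tr X (a - a')).card : ℝ) := by
    have := sum_rep_sq A X
    have e : ∑ z, (rep A X z : ℝ) ^ 2 = ∑ a ∈ A, ∑ a' ∈ A, ((X ∩ tr X (a - a')).card : ℝ) := by
      exact_mod_cast this
    rw [← e]
    exact sum_le_sum_of_subset_of_nonneg (subset_univ _) (fun _ _ _ => by positivity)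
  have hbd : ∑ a ∈ A, ∑ a' ∈ A, ((X ∩ tr X (a - a')).card : ℝ) ≤
      A.card * X.card + A.card ^ 2 * (X.card ^ 2 / (8 * Q)) := by
    have : ∀ a ∈ A, ∑ a' ∈ A, ((X ∩ tr X (a - a')).card : ℝ) ≤ X.card + A.card * (X.card ^ 2 / (8 * Q)) := by
      intro a ha
      have : ∀ a' ∈ A, ((X ∩ tr X (a - a')).card : ℝ) ≤ (if a' = a then (X.card : ℝ) else 0) + X.card ^ 2 / (8 * Q) := by
        intro a' _
        split_ifs with hif
        · have : ((X ∩ tr X (a - a')).card : ℝ) ≤ X.card := by exact_mod_cast card_le_card inter_subset_left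
          have : (0:ℝ) ≤ X.card ^ 2 / (8 * Q) := by positivity
          linarith
        · have := hcon (a - a') (sub_ne_zero.2 (Ne.symm hif))
          rw [zero_add, le_div_iff₀ (by positivity)]; linarith
      refine (sum_le_sum this).trans ?_
      rw [sum_add_distrib]; simp [ha]
    refine (sum_le_sum this).trans ?_
    rw [sum_const, nsmul_eq_mul]; apply le_of_eq; ring
  set M : ℝ := (A.card : ℝ) * X.card with hM
  have hMpos : 0 < M := by linarith
  have hsq0 : 0 ≤ ∑ z ∈ S, (rep A X z : ℝ) ^ 2 := sum_nonneg (fun _ _ => by positivity)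
  have f1 : (M / 2) ^ 2 ≤ Q * ∑ z ∈ S, (rep A X z : ℝ) ^ 2 := by
    calc (M/2)^2 ≤ (∑ z ∈ S, (rep A X z : ℝ)) ^ 2 := by
            apply pow_le_pow_left₀ (by positivity) hsumS
      _ ≤ _ := hCS
      _ ≤ _ := mul_le_mul_of_nonneg_right hSc hsq0
  have f2 : Q * ∑ z ∈ S, (rep A X z : ℝ) ^ 2 ≤ Q * (M + M ^ 2 / (8 * Q)) := by
    apply mul_le_mul_of_nonneg_left _ hQ.le
    refine (hsq.trans hbd).trans (le_of_eq ?_)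
    rw [hM]; ring
  have f3 : Q * (M + M ^ 2 / (8 * Q)) = Q * M + M ^ 2 / 8 := by field_simp
  rw [f3] at f2
  nlinarith

lemma step (t : ℕ) (X B : Finset (ZMod p)) (τ : ZMod p) (D : ℝ) (h1 : t ≤ B.card) (h2 : t ≤ X.card)
    (h3 : B.card + (X ∪ tr X τ).card ≤ p) (h : (gg t X B : ℝ) ≤ t * (X.card + B.card + D)) :
    (gg t (X ∩ tr X τ) B : ℝ) ≤ t * ((X ∩ tr X τ).card + B.card + (2 * D + t)) := by
  have e1 := gg_submod t X (tr X τ) B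
  rw [gg_tr] at e1
  have h4 : X.card ≤ (X ∪ tr X τ).card := card_le_card subset_union_left
  have e2 := pollard (t := t) (A := X ∪ tr X τ) (B := B) (by omega) h1 (by omega)
  have e3 := card_union_add_card_inter X (tr X τ)
  rw [card_tr] at e3
  have e1' : (gg t (X ∩ tr X τ) B : ℝ) + gg t (X ∪ tr X τ) B ≤ gg t X B + gg t X B := by exact_mod_cast e1
  have e2' : (t : ℝ) * ((X ∪ tr X τ).card + B.card - t) ≤ gg t (X ∪ tr X τ) B := by
    have : ((t * ((X ∪ tr X τ).card + B.card - t) : ℕ) : ℝ) ≤ gg t (X ∪ tr X τ) B := by exact_mod_cast e2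
    rw [Nat.cast_mul, Nat.cast_sub (by omega)] at this
    push_cast at this; exact this
  have e3' : ((X ∪ tr X τ).card : ℝ) + (X ∩ tr X τ).card = X.card + X.card := by exact_mod_cast e3
  have : ((X ∪ tr X τ).card : ℝ) = X.card + X.card - (X ∩ tr X τ).card := by linarith
  rw [this] at e2'
  nlinarith
end shrink

section shrink2
variable {p : ℕ} [Fact p.Prime]

lemma exists_big_nn (X : Finset (ZMod p)) (h : 2 * X.card ≤ p) (hX : 0 < X.card) :
    ∃ x, X.card ≤ 2 * nn X x := by
  by_contra! hcon
  have h1 := sum_inter X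
  have h2 : ∀ x ∈ (univ : Finset (ZMod p)), X.card + 1 ≤ 2 * (X.filter (fun c => c + x ∈ X)).card := by
    intro x _
    have := hcon x
    have := nn_add_card X x
    omega
  have h3 := card_nsmul_le_sum _ _ _ h2
  rw [← mul_sum, h1, card_univ, ZMod.card, smul_eq_mul] at h3
  have : p * X.card ≥ 2 * X.card * X.card := Nat.mul_le_mul_right _ h
  have hp : 0 < p := (Fact.out : p.Prime).pos
  nlinarith

lemma shrink_step (t : ℕ) (ht : 0 < t) (A X : Finset (ZMod p)) (σ C1 D : ℝ) (hσ : 0 < σ) (hσ1 : σ ≤ 1)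
    (hX : σ * A.card < X.card) (hXC : (X.card : ℝ) ≤ C1 * A.card) (hp : A.card + 2 * X.card ≤ p)
    (htD : (t:ℝ) ≤ D) (hDa : D ≤ A.card) (hC1 : 0 < C1)
    (ht1 : t * (C1 + 2) ≤ σ * A.card / 2) (ha : 8 * (C1 + 2) < σ * A.card)
    (h : (gg t X A : ℝ) ≤ t * (X.card + A.card + D)) :
    ∃ X' ⊆ X, (X'.card : ℝ) ≤ X.card - σ / 4 * A.card ∧ σ ^ 2 * A.card ≤ 8 * (C1 + 2) * X'.card ∧
      (gg t X' A : ℝ) ≤ t * (X'.card + A.card + 3 * D) := by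
  set a : ℝ := (A.card : ℝ) with haa
  have htR : (0:ℝ) < t := by exact_mod_cast ht
  have ha0 : 0 < a := by nlinarith
  have hσa : σ * a ≤ a := by nlinarith
  have hta : (t:ℝ) ≤ σ * a := by nlinarith
  have htA : t ≤ A.card := by
    have : (t:ℝ) ≤ a := by linarith
    rw [haa] at this; exact_mod_cast this
  have htX : t ≤ X.card := by
    have : (t:ℝ) ≤ X.card := by linarith
    exact_mod_cast this
  have hX0 : 0 < X.card := by omega
  have hX0R : (0:ℝ) < X.card := by exact_mod_cast hX0
  -- the inductive construction for a shift
  have hstep : ∀ τ : ZMod p, σ / 4 * a ≤ nn X τ → σ ^ 2 * a ≤ 8 * (C1 + 2) * (X ∩ tr X τ).card →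
    ∃ X' ⊆ X, (X'.card : ℝ) ≤ X.card - σ / 4 * a ∧ σ ^ 2 * a ≤ 8 * (C1 + 2) * X'.card ∧
      (gg t X' A : ℝ) ≤ t * (X'.card + a + 3 * D) := by
    intro τ h1 h2
    refine ⟨X ∩ tr X τ, inter_subset_left, ?_, h2, ?_⟩
    · have : ((X ∩ tr X τ).card : ℝ) + nn X τ = X.card := by exact_mod_cast inter_tr_add X τ
      linarith
    · have hu : (X ∪ tr X τ).card ≤ X.card + X.card := by
        have := card_union_le X (tr X τ); rwa [card_tr] at this
      have := step t X A τ D htA htX (by omega) h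
      refine this.trans ?_
      apply mul_le_mul_of_nonneg_left _ htR.le
      linarith
  obtain ⟨τ, hτ0, hτ⟩ := lemE t ht A X (X.card + a + D) (by linarith) (by rw [gg_comm]; exact h)
    (by
      have : X.card + a + D ≤ (C1 + 2) * a := by linarith
      calc t * (X.card + a + D) ≤ t * ((C1 + 2) * a) := mul_le_mul_of_nonneg_left this htR.le
        _ = (t * (C1 + 2)) * a := by ring
        _ ≤ (σ * a / 2) * a := mul_le_mul_of_nonneg_right ht1 ha0.le
        _ ≤ a * X.card / 2 := by nlinarith)
    (by
      have : X.card + a + D ≤ (C1 + 2) * a := by linarith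
      have h3 : 8 * (C1 + 2) * a < σ * a * a := mul_lt_mul_of_pos_right ha ha0
      have h4 : σ * a * a < X.card * a := mul_lt_mul_of_pos_right hX ha0
      show _ < a * (X.card : ℝ)
      linarith)
  have hτ' : σ ^ 2 * a ≤ 8 * (C1 + 2) * (X ∩ tr X τ).card := by
    have h1 : X.card + a + D ≤ (C1 + 2) * a := by linarith
    have h2 : (0:ℝ) ≤ (X ∩ tr X τ).card := by positivity
    have h3 : (σ * a) ^ 2 ≤ (X.card : ℝ) ^ 2 := pow_le_pow_left₀ (by positivity) hX.le _
    have h4 : 8 * (X.card + a + D) * ((X ∩ tr X τ).card : ℝ) ≤ 8 * ((C1 + 2) * a) * (X ∩ tr X τ).card := by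
      apply mul_le_mul_of_nonneg_right _ h2; linarith
    have h5 : (σ ^ 2 * a) * a ≤ (8 * (C1 + 2) * (X ∩ tr X τ).card) * a := by nlinarith
    exact le_of_mul_le_mul_right h5 ha0
  by_cases hcase : σ / 4 * a ≤ nn X τ
  · exact hstep τ hcase hτ'
  · push Not at hcase
    obtain ⟨x, hx⟩ := exists_big_nn X (by omega) hX0
    have hxR : (X.card : ℝ) ≤ 2 * nn X x := by exact_mod_cast hx
    have hex : ∃ j : ℕ, σ / 4 * a ≤ nn X (j * τ) := by
      obtain ⟨j, _, e⟩ := exists_coord 0 τ x hτ0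
      refine ⟨j, ?_⟩
      rw [zero_add] at e
      rw [← e]; linarith
    classical
    set j := Nat.find hex with hj
    have hjs := Nat.find_spec hex
    rw [← hj] at hjs
    have hj0 : j ≠ 0 := by
      intro h0
      rw [h0] at hjs
      simp [nn_zero] at hjs
      nlinarith
    obtain ⟨i, hi⟩ := Nat.exists_eq_succ_of_ne_zero hj0
    have hmin : (nn X (i * τ) : ℝ) < σ / 4 * a := not_le.1 (Nat.find_min hex (by omega))
    have hup : (nn X (j * τ) : ℝ) ≤ nn X (i * τ) + nn X τ := by
      have := nn_add X (i * τ) τ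
      have e : (i : ZMod p) * τ + τ = j * τ := by rw [hi]; push_cast; ring
      rw [e] at this; exact_mod_cast this
    apply hstep _ hjs
    have e : ((X ∩ tr X (j * τ)).card : ℝ) + nn X (j * τ) = X.card := by exact_mod_cast inter_tr_add X _
    have : σ * a / 2 ≤ (X ∩ tr X (j * τ)).card := by linarith
    nlinarith [mul_pos hC1 (mul_pos hσ ha0)]

lemma shrink (t : ℕ) (ht : 0 < t) (A B : Finset (ZMod p)) (σ C1 D : ℝ) (n0 : ℕ) (hσ : 0 < σ) (hσ1 : σ ≤ 1)
    (hB : σ * A.card ≤ B.card) (hBC : (B.card : ℝ) ≤ C1 * A.card) (hp : A.card + 2 * B.card ≤ p)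
    (htD : (t:ℝ) ≤ D) (hDa : 3 ^ n0 * D ≤ A.card) (hC1 : 0 < C1) (hn0 : C1 < n0 * (σ / 4))
    (ht1 : t * (C1 + 2) ≤ σ * A.card / 2) (ha : 8 * (C1 + 2) < σ * A.card)
    (h : (gg t B A : ℝ) ≤ t * (B.card + A.card + D)) :
    ∃ X : Finset (ZMod p), (X.card : ℝ) ≤ σ * A.card ∧ σ ^ 2 * A.card ≤ 8 * (C1 + 2) * X.card ∧
      (gg t X A : ℝ) ≤ t * (X.card + A.card + 3 ^ n0 * D) := by
  have htR : (0:ℝ) < t := by exact_mod_cast ht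
  have hA0 : (0:ℝ) < A.card := by nlinarith
  have hD0 : 0 < D := by linarith
  have key : ∀ n : ℕ, n ≤ n0 → ∃ X ⊆ B, ((X.card : ℝ) ≤ σ * A.card ∨ (X.card : ℝ) ≤ B.card - n * (σ / 4 * A.card)) ∧
      σ ^ 2 * A.card ≤ 8 * (C1 + 2) * X.card ∧ (gg t X A : ℝ) ≤ t * (X.card + A.card + 3 ^ n * D) := by
    intro n
    induction n with
    | zero =>
      intro _
      refine ⟨B, Subset.rfl, Or.inr (by simp), ?_, by simpa using h⟩
      have : σ * (σ * A.card) ≤ 1 * B.card := mul_le_mul hσ1 hB (by positivity) (by norm_num)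
      have : (0:ℝ) ≤ B.card := by positivity
      nlinarith
    | succ n ih =>
      intro hn
      obtain ⟨X, hXB, hX1, hX2, hX3⟩ := ih (by omega)
      by_cases hs : (X.card : ℝ) ≤ σ * A.card
      · refine ⟨X, hXB, Or.inl hs, hX2, hX3.trans ?_⟩
        apply mul_le_mul_of_nonneg_left _ htR.le
        have : (3:ℝ) ^ n * D ≤ 3 ^ (n + 1) * D := by
          apply mul_le_mul_of_nonneg_right _ hD0.le
          exact pow_le_pow_right₀ (by norm_num) (by omega)
        linarith
      · have hX1' := hX1.resolve_left hs
        push Not at hs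
        have hXc : X.card ≤ B.card := card_le_card hXB
        have hXcR : (X.card : ℝ) ≤ B.card := by exact_mod_cast hXc
        have h3 : (3:ℝ) ^ n * D ≤ 3 ^ n0 * D := by
          apply mul_le_mul_of_nonneg_right _ hD0.le
          exact pow_le_pow_right₀ (by norm_num) (by omega)
        have h4 : D ≤ (3:ℝ) ^ n * D := by
          have : (1:ℝ) ≤ 3 ^ n := one_le_pow₀ (by norm_num)
          nlinarith
        obtain ⟨X', hX', e1, e2, e3⟩ := shrink_step t ht A X σ C1 (3 ^ n * D) hσ hσ1 hs (hXcR.trans hBC) (by omega)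
          (by linarith) (by linarith) hC1 ht1 ha hX3
        refine ⟨X', hX'.trans hXB, Or.inr ?_, e2, ?_⟩
        · push_cast; linarith
        · rw [pow_succ]; convert e3 using 3; ring
  obtain ⟨X, _, hX1, hX2, hX3⟩ := key n0 le_rfl
  refine ⟨X, ?_, hX2, hX3⟩
  rcases hX1 with h1 | h1
  · exact h1
  · exfalso
    have : (0:ℝ) ≤ X.card := by positivity
    have : C1 * A.card < n0 * (σ / 4) * A.card := mul_lt_mul_of_pos_right hn0 hA0
    nlinarith
end shrink2

section propII

lemma propII_core {p : ℕ} [Fact p.Prime] (t : ℕ) (ht : 0 < t) (A X : Finset (ZMod p)) (σ D : ℝ)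
    (h2 : 2 * A.card ≤ p) (hXσ : (X.card : ℝ) ≤ σ * A.card) (hX0 : 0 < X.card)
    (h : (gg t X A : ℝ) ≤ t * (X.card + A.card + D)) (h3 : 3 * t * A.card ≤ D ^ 2)
    (hDσ : D ≤ σ * A.card) (hD2 : 2 ≤ D) (h9 : 9 * A.card * D ≤ 2 * (X.card : ℝ) ^ 2)
    (hσ : σ * (4 * 10 ^ 7) ≤ 1) :
    ∃ (d a0 : ZMod p) (len : ℕ), d ≠ 0 ∧
      ((symmDiff A (zmodAP p a0 d len)).card : ℝ) ≤ 128000 * σ * A.card := by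
  have htR : (0:ℝ) < t := by exact_mod_cast ht
  have hX0R : (0:ℝ) < X.card := by exact_mod_cast hX0
  set a : ℝ := (A.card : ℝ) with haa
  have ha0 : 0 ≤ a := by positivity
  have hσa : σ * a * (4 * 10 ^ 7) ≤ a := by nlinarith
  obtain ⟨X', hX'X, hX'c, hX'⟩ := good t ht X A D (by linarith) h
  have hX'c2 : (X.card : ℝ) - X'.card ≤ D := by
    have h4 : t * (X.card + a + D) ≤ t * (3 * a) := by
      apply mul_le_mul_of_nonneg_left _ htR.le; linarith
    have h5 : ((X.card : ℝ) - X'.card) * D ≤ D * D := by nlinarith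
    exact le_of_mul_le_mul_right h5 (by linarith)
  have hDX : 2 * D ≤ X.card := by
    have : 9 * D * a ≤ 2 * X.card * (σ * a) := by nlinarith
    have : 9 * D * (σ * a * (4 * 10 ^ 7)) ≤ 2 * X.card * (σ * a) := by nlinarith
    have h6 : 9 * D * (4 * 10 ^ 7) ≤ 2 * X.card := by
      have : (9 * D * (4 * 10 ^ 7)) * (σ * a) ≤ (2 * X.card) * (σ * a) := by nlinarith
      exact le_of_mul_le_mul_right this (by linarith)
    linarith
  have hX'ne : X'.Nonempty := by
    rw [← card_pos]
    have : (0:ℝ) < X'.card := by linarith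
    exact_mod_cast this
  set W := X' - X' with hW
  have hCD : 2 * X'.card - 1 ≤ W.card := by
    have h7 := ZMod.cauchy_davenport (Fact.out : p.Prime) hX'ne hX'ne.neg
    rw [← sub_eq_add_neg, card_neg] at h7
    have h8 : X'.card ≤ A.card := by
      have e1 : X'.card ≤ X.card := card_le_card hX'X
      have : (X.card : ℝ) ≤ a := by linarith
      have : X.card ≤ A.card := by rw [haa] at this; exact_mod_cast this
      omega
    rw [min_eq_right (by omega)] at h7
    rw [hW]; omega
  have hCDR : 2 * (X'.card : ℝ) - 1 ≤ W.card := by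
    have h9 : 0 < X'.card := hX'ne.card_pos
    have : 2 * X'.card ≤ W.card + 1 := by omega
    have : 2 * (X'.card : ℝ) ≤ W.card + 1 := by exact_mod_cast this
    linarith
  set r := ⌊(X.card : ℝ) + 3 * D⌋₊ with hr
  have hr1 : (r : ℝ) ≤ X.card + 3 * D := Nat.floor_le (by positivity)
  have hr2 : X.card ≤ r := Nat.le_floor (by linarith)
  have hr2R : (X.card : ℝ) ≤ r := by exact_mod_cast hr2
  have hr4 : (r:ℝ) ≤ 4 * σ * a := by linarith
  obtain ⟨d, a0, len, hd, hfin⟩ := lemMT A W r (by omega)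
    (by
      have : (10:ℝ) ^ 7 * r ≤ a := by linarith
      rw [haa] at this; exact_mod_cast this) h2 (hX'ne.sub hX'ne)
    (by
      intro w hw
      obtain ⟨x, hx, x', hx', rfl⟩ := mem_sub.1 hw
      exact Nat.le_floor (hX' x hx x' hx'))
    (by
      have h10 : 2 * (r:ℝ) - ((W.card : ℝ) - 1) ≤ 9 * D := by linarith
      have h11 : a * (2 * (r:ℝ) - ((W.card : ℝ) - 1)) ≤ a * (9 * D) := mul_le_mul_of_nonneg_left h10 ha0
      have h12 : (X.card : ℝ) ^ 2 ≤ (r:ℝ) ^ 2 := pow_le_pow_left₀ hX0R.le hr2R 2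
      rw [← haa]; linarith)
  refine ⟨d, a0, len, hd, ?_⟩
  have : ((symmDiff A (zmodAP p a0 d len)).card : ℝ) ≤ 32000 * r := by exact_mod_cast hfin
  linarith

set_option maxHeartbeats 1600000 in
lemma propII (g C1 c1 : ℝ) (hg : 0 < g) (hC1 : 0 < C1) (hc1 : 0 < c1) :
    ∃ ε δ N : ℝ, 0 < ε ∧ 0 < δ ∧ 0 < N ∧ ∀ (p : ℕ) [Fact p.Prime] (A B : Finset (ZMod p)) (t : ℕ),
      0 < t → N ≤ A.card → 2 * A.card ≤ p → c1 * A.card ≤ B.card → (B.card : ℝ) ≤ C1 * A.card →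
      A.card + 2 * B.card ≤ p → (t : ℝ) ≤ δ * A.card →
      (gg t B A : ℝ) ≤ t * (B.card + A.card + ε * A.card) →
      ∃ (d a0 : ZMod p) (len : ℕ), d ≠ 0 ∧
        ((symmDiff A (zmodAP p a0 d len)).card : ℝ) ≤ g * A.card := by
  obtain ⟨σ, hσ0, hσc, hσg, hσ7⟩ : ∃ σ : ℝ, 0 < σ ∧ σ ≤ c1 ∧ 128000 * σ ≤ g ∧ σ * (4 * 10 ^ 7) ≤ 1 := by
    refine ⟨min c1 (min (g / 128000) (1 / (4 * 10 ^ 7))), ?_, min_le_left _ _, ?_, ?_⟩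
    · positivity
    · have : min c1 (min (g / 128000) (1 / (4 * 10 ^ 7))) ≤ g / 128000 := (min_le_right _ _).trans (min_le_left _ _)
      linarith
    · have : min c1 (min (g / 128000) (1 / (4 * 10 ^ 7))) ≤ 1 / (4 * 10 ^ 7) := (min_le_right _ _).trans (min_le_right _ _)
      linarith
  have hσ1 : σ ≤ 1 := by linarith
  set L : ℝ := 8 * (C1 + 2) with hL
  have hL0 : 16 < L := by linarith
  set v : ℝ := σ ^ 2 / L with hv
  have hv0 : 0 < v := by positivity
  have hv1 : v ≤ 1 := by
    rw [hv, div_le_one (by linarith)]; nlinarith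
  set η : ℝ := σ * v ^ 2 / 9 with hη
  have hη0 : 0 < η := by positivity
  have hv21 : v ^ 2 ≤ 1 := by nlinarith
  have hησ : η ≤ σ := by rw [hη]; nlinarith
  have h9η : 9 * η ≤ 2 * v ^ 2 := by rw [hη]; nlinarith [sq_nonneg v]
  obtain ⟨n0, hn0⟩ := exists_nat_gt (C1 / (σ / 4))
  have hn0' : C1 < n0 * (σ / 4) := by rwa [div_lt_iff₀ (by positivity)] at hn0
  set ε : ℝ := η / 3 ^ n0 with hε
  have hε0 : 0 < ε := by positivity
  refine ⟨ε, min ε (min (σ / (2 * (C1 + 2))) (η ^ 2 / 3)), max (2 / η) (L / σ + 1), hε0, by positivity, by positivity, ?_⟩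
  intro p _ A B t ht hN h2 hcB hBC hp htδ hgg
  set a : ℝ := (A.card : ℝ) with haa
  have hN1 : 2 / η ≤ a := (le_max_left _ _).trans hN
  have hN2 : L / σ + 1 ≤ a := (le_max_right _ _).trans hN
  have ha0 : 0 < a := lt_of_lt_of_le (by positivity) hN1
  have hN1' : 2 ≤ η * a := by rw [div_le_iff₀ hη0] at hN1; linarith
  have hN2' : L < σ * a := by
    have : L / σ < a := by linarith
    rw [div_lt_iff₀ hσ0] at this; linarith
  have ht1 : (t:ℝ) ≤ ε * a := htδ.trans (mul_le_mul_of_nonneg_right (min_le_left _ _) ha0.le)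
  have ht2 : (t:ℝ) ≤ σ / (2 * (C1 + 2)) * a := htδ.trans (mul_le_mul_of_nonneg_right ((min_le_right _ _).trans (min_le_left _ _)) ha0.le)
  have ht3 : (t:ℝ) ≤ η ^ 2 / 3 * a := htδ.trans (mul_le_mul_of_nonneg_right ((min_le_right _ _).trans (min_le_right _ _)) ha0.le)
  have hεη : 3 ^ n0 * (ε * a) = η * a := by rw [hε]; field_simp
  obtain ⟨X, hX1, hX2, hX3⟩ := shrink t ht A B σ C1 (ε * a) n0 hσ0 hσ1
    ((mul_le_mul_of_nonneg_right hσc ha0.le).trans hcB) hBC hp ht1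
    (by rw [hεη]; exact (mul_le_mul_of_nonneg_right (hησ.trans hσ1) ha0.le).trans (one_mul _).le) hC1 hn0'
    (by
      have : σ / (2 * (C1 + 2)) * a * (C1 + 2) = σ * a / 2 := by field_simp
      rw [← haa, ← this]
      exact mul_le_mul_of_nonneg_right ht2 (by linarith)) hN2' hgg
  rw [hεη] at hX3
  have hvX : v * a ≤ X.card := by
    rw [hv, div_mul_eq_mul_div, div_le_iff₀ (by linarith)]; linarith
  have hX0 : 0 < X.card := by
    have : (0:ℝ) < X.card := lt_of_lt_of_le (by positivity) hvX
    exact_mod_cast this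
  obtain ⟨d, a0, len, hd, hf⟩ := propII_core t ht A X σ (η * a) h2 hX1 hX0 hX3
    (by
      have := mul_le_mul_of_nonneg_right ht3 ha0.le
      have e : (η * a) ^ 2 = 3 * (η ^ 2 / 3 * a * a) := by ring
      rw [e, mul_assoc]; linarith) (mul_le_mul_of_nonneg_right hησ ha0.le) hN1'
    (by
      rw [← haa]
      have : (v * a) ^ 2 ≤ (X.card : ℝ) ^ 2 := pow_le_pow_left₀ (by positivity) hvX 2
      have : 9 * η * a ^ 2 ≤ 2 * v ^ 2 * a ^ 2 := mul_le_mul_of_nonneg_right h9η (by positivity)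
      calc 9 * a * (η * a) = 9 * η * a ^ 2 := by ring
        _ ≤ 2 * v ^ 2 * a ^ 2 := this
        _ = 2 * (v * a) ^ 2 := by ring
        _ ≤ _ := by linarith) hσ7
  refine ⟨d, a0, len, hd, hf.trans ?_⟩
  exact mul_le_mul_of_nonneg_right hσg ha0.le
end propII

section propD

lemma gg_one {p : ℕ} [Fact p.Prime] (A B : Finset (ZMod p)) : gg 1 A B = (A + B).card := by
  unfold gg
  have : ∀ z, min (rep A B z) 1 = if z ∈ A + B then 1 else 0 := by
    intro z
    split_ifs with h
    · obtain ⟨a, ha, b, hb, rfl⟩ := mem_add.1 h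
      apply min_eq_right
      rw [Nat.one_le_iff_ne_zero, rep, Ne, card_eq_zero, filter_eq_empty_iff]
      push Not
      exact ⟨a, ha, by simpa using hb⟩
    · have : rep A B z = 0 := by
        rw [rep, card_eq_zero, filter_eq_empty_iff]
        intro a ha hb
        exact h (mem_add.2 ⟨a, ha, _, hb, by ring⟩)
      rw [this]; rfl
  simp_rw [this]
  rw [← card_filter]; congr 1; ext z; simp

lemma dual {p : ℕ} [Fact p.Prime] (t t2 : ℕ) (ht : 0 < t) (A B : Finset (ZMod p)) (D : ℝ) (hD : 0 ≤ D)
    (hp : A.card + B.card ≤ p) (h : (gg t A B : ℝ) ≤ t * (A.card + B.card + D)) :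
    ∃ C : Finset (ZMod p), C.card + A.card + B.card ≤ p ∧ (p : ℝ) - A.card - B.card - D ≤ C.card ∧
      (gg t2 C A : ℝ) ≤ t2 * (C.card + A.card + D) + t * (A.card + B.card + D) := by
  set S := univ.filter (fun z => t ≤ rep A B z) with hS
  set R := (∑ z ∈ univ.filter (fun z => ¬ t ≤ rep A B z), rep A B z) with hR
  have htR : (0:ℝ) < t := by exact_mod_cast ht
  have hsplit : (gg t A B : ℝ) = t * S.card + (R : ℝ) := by
    rw [gg_split, hR]; push_cast; rfl
  have hR0 : (0:ℝ) ≤ R := by positivity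
  have hS0 : (0:ℝ) ≤ t * S.card := by positivity
  have hSc : (S.card : ℝ) ≤ A.card + B.card + D := by
    have : (t:ℝ) * S.card ≤ t * (A.card + B.card + D) := by linarith
    exact le_of_mul_le_mul_left this htR
  set C0 := (Sᶜ).image (fun z => -z) with hC0
  have hC0c : C0.card + S.card = p := by
    rw [hC0, card_image_of_injective _ neg_injective, card_compl, ZMod.card]
    have : S.card ≤ p := by have := card_le_univ S; rwa [ZMod.card] at this
    omega
  obtain ⟨C, hCC0, hCc⟩ := exists_subset_card_eq (s := C0) (n := min C0.card (p - A.card - B.card)) (min_le_left _ _)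
  have hC0R : (C0.card : ℝ) + S.card = p := by exact_mod_cast hC0c
  have hlow : (p : ℝ) - A.card - B.card - D ≤ C.card := by
    rw [hCc]
    rcases min_cases C0.card (p - A.card - B.card) with ⟨e, _⟩ | ⟨e, _⟩
    · rw [e]; linarith
    · rw [e, Nat.sub_sub, Nat.cast_sub hp]; push_cast; linarith
  refine ⟨C, ?_, hlow, ?_⟩
  · have : C.card ≤ p - A.card - B.card := by rw [hCc]; exact min_le_right _ _
    omega
  · -- split according to w ∈ -B
    have key : gg t2 C A ≤ t2 * (p - B.card) + R := by
      rw [gg_comm]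
      unfold gg
      rw [← sum_filter_add_sum_filter_not univ (fun w : ZMod p => -w ∈ B), add_comm]
      apply add_le_add
      · calc _ ≤ ∑ w ∈ univ.filter (fun w : ZMod p => ¬ -w ∈ B), t2 := sum_le_sum (fun _ _ => min_le_right _ _)
          _ = t2 * (univ.filter (fun w : ZMod p => ¬ -w ∈ B)).card := by simp [mul_comm]
          _ = _ := by
            congr 1
            have e : (univ.filter (fun w : ZMod p => ¬ -w ∈ B)) = (B.image (fun z => -z))ᶜ := by
              ext w; simp [neg_eq_iff_eq_neg]
            rw [e, card_compl, ZMod.card, card_image_of_injective _ neg_injective]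
      · calc _ ≤ ∑ w ∈ univ.filter (fun w : ZMod p => -w ∈ B), rep A C w := sum_le_sum (fun _ _ => min_le_left _ _)
          _ ≤ ∑ w ∈ univ.filter (fun w : ZMod p => -w ∈ B), rep A C0 w :=
              sum_le_sum (fun _ _ => rep_mono Subset.rfl hCC0 _)
          _ = R := by
            rw [hR]
            unfold rep
            simp_rw [card_filter]
            rw [sum_comm, sum_comm (s := univ.filter _)]
            apply sum_congr rfl
            intro a _
            rw [← card_filter, ← card_filter, filter_filter, filter_filter]
            apply card_bij (fun w _ => a - w)
            · intro w hw
              simp only [hC0, mem_image, mem_compl, mem_filter, mem_univ, true_and, hS, rep, card_filter] at hw ⊢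
              obtain ⟨h1, z, h2, h3⟩ := hw
              have e : a - w = z := by rw [← neg_sub, ← h3, neg_neg]
              refine ⟨by rw [e]; exact h2, by simpa using h1⟩
            · intro x _ y _ h; exact sub_right_injective h
            · intro z hz
              simp only [hC0, mem_image, mem_compl, mem_filter, mem_univ, true_and, hS, rep, card_filter] at hz ⊢
              refine ⟨a - z, ⟨by simpa using hz.2, z, hz.1, by ring⟩, by ring⟩
    have keyR : (gg t2 C A : ℝ) ≤ t2 * (p - B.card) + R := by
      have : ((gg t2 C A : ℕ) : ℝ) ≤ ((t2 * (p - B.card) + R : ℕ) : ℝ) := by exact_mod_cast key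
      rw [Nat.cast_add, Nat.cast_mul, Nat.cast_sub (by omega)] at this
      exact this
    have : (t2:ℝ) * (p - B.card) ≤ t2 * (C.card + A.card + D) := by
      apply mul_le_mul_of_nonneg_left _ (by positivity); linarith
    linarith
end propD

section propD2

lemma caseII (β g C0 : ℝ) (hβ : 0 < β) (hβ1 : β ≤ 1) (hg : 0 < g) (hC0 : 0 < C0) :
    ∃ ε δ N : ℝ, 0 < ε ∧ 0 < δ ∧ 0 < N ∧ ∀ (p : ℕ) [Fact p.Prime] (A B : Finset (ZMod p)) (t : ℕ),
      0 < t → N ≤ A.card → A.card ≤ B.card → (B.card : ℝ) ≤ C0 * A.card →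
      (A.card : ℝ) + B.card ≤ (1 - β) * p → (t : ℝ) ≤ δ * A.card →
      (gg t A B : ℝ) ≤ t * (A.card + B.card + ε * A.card) →
      ∃ (d a0 : ZMod p) (len : ℕ), d ≠ 0 ∧
        ((symmDiff A (zmodAP p a0 d len)).card : ℝ) ≤ g * A.card := by
  obtain ⟨ε2, δ2, N2, hε2, hδ2, hN2, H⟩ := propII g (2 * C0 + 1) β hg (by linarith) hβ
  refine ⟨min (ε2 / 2) β, min δ2 (δ2 * ε2 / (4 * (C0 + 2))), max N2 (2 / δ2), by positivity, by positivity, by positivity, ?_⟩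
  intro p _ A B t ht hN hAB hBC hp htδ hgg
  set a : ℝ := (A.card : ℝ) with haa
  set b : ℝ := (B.card : ℝ) with hbb
  have hab : a ≤ b := by rw [haa, hbb]; exact_mod_cast hAB
  have htR : (0:ℝ) < t := by exact_mod_cast ht
  have hN1 : N2 ≤ a := (le_max_left _ _).trans hN
  have hN3 : 2 / δ2 ≤ a := (le_max_right _ _).trans hN
  have ha0 : 0 < a := lt_of_lt_of_le hN2 hN1
  have hp0 : (0:ℝ) ≤ p := by positivity
  have hβp : 0 ≤ β * p := by positivity
  have hpR : a + b ≤ p := by linarith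
  have hpN : A.card + B.card ≤ p := by rw [haa, hbb] at hpR; exact_mod_cast hpR
  have h2 : 2 * A.card ≤ p := by omega
  have ht1 : (t:ℝ) ≤ δ2 * a := htδ.trans (mul_le_mul_of_nonneg_right (min_le_left _ _) ha0.le)
  have ht2 : (t:ℝ) ≤ δ2 * ε2 / (4 * (C0 + 2)) * a := htδ.trans (mul_le_mul_of_nonneg_right (min_le_right _ _) ha0.le)
  set ε := min (ε2 / 2) β with hε
  have hε0 : 0 < ε := by positivity
  have hεa : ε ≤ ε2 / 2 := min_le_left _ _
  have hεb : ε ≤ β := min_le_right _ _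
  by_cases hcase : A.card + 2 * B.card ≤ p
  · apply H p A B t ht hN1 h2 (by rw [← haa, ← hbb]; nlinarith) (by rw [← haa, ← hbb]; nlinarith) hcase ht1
    rw [gg_comm]
    refine hgg.trans ?_
    apply mul_le_mul_of_nonneg_left _ htR.le
    rw [← haa, ← hbb]; nlinarith
  · push Not at hcase
    have hδa : 2 ≤ δ2 * a := by rw [div_le_iff₀ hδ2] at hN3; linarith
    set t2 := ⌊δ2 * a⌋₊ with ht2d
    have g1 : (t2 : ℝ) ≤ δ2 * a := Nat.floor_le (by positivity)
    have g2 : δ2 * a < t2 + 1 := Nat.lt_floor_add_one _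
    have g3 : δ2 * a / 2 ≤ t2 := by linarith
    have g4 : 0 < t2 := by
      have : (0:ℝ) < t2 := by linarith
      exact_mod_cast this
    obtain ⟨C, hC1, hC2, hC3⟩ := dual t t2 ht A B (ε * a) (by positivity) hpN hgg
    rw [← haa, ← hbb] at hC2
    have hCa : (p : ℝ) < a + 2 * b := by rw [haa, hbb]; exact_mod_cast hcase
    have hC1R : (C.card : ℝ) + a + b ≤ p := by rw [haa, hbb]; exact_mod_cast hC1
    apply H p A C t2 g4 hN1 h2 _ _ (by omega) g1 _
    · rw [← haa]
      have : β * (2 * a) ≤ β * p := mul_le_mul_of_nonneg_left (by linarith) hβ.le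
      have : ε * a ≤ β * a := mul_le_mul_of_nonneg_right hεb ha0.le
      linarith
    · rw [← haa]; linarith
    · refine hC3.trans ?_
      rw [← haa, ← hbb]
      have q1 : a + b + ε * a ≤ (C0 + 2) * a := by
        have : ε * a ≤ 1 * a := mul_le_mul_of_nonneg_right (hεb.trans hβ1) ha0.le
        linarith
      have q2 : t * (a + b + ε * a) ≤ (δ2 * ε2 / (4 * (C0 + 2)) * a) * ((C0 + 2) * a) :=
        mul_le_mul ht2 q1 (by positivity) (by positivity)
      have q3 : (δ2 * ε2 / (4 * (C0 + 2)) * a) * ((C0 + 2) * a) = (δ2 * a / 2) * (ε2 / 2 * a) := by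
        field_simp; ring
      have q4 : (δ2 * a / 2) * (ε2 / 2 * a) ≤ t2 * (ε2 / 2 * a) := mul_le_mul_of_nonneg_right g3 (by positivity)
      have q5 : t2 * (ε * a) ≤ t2 * (ε2 / 2 * a) := by
        apply mul_le_mul_of_nonneg_left _ (by positivity)
        exact mul_le_mul_of_nonneg_right hεa ha0.le
      nlinarith

set_option maxHeartbeats 1600000 in
lemma caseI (β g : ℝ) (hβ : 0 < β) (hβ1 : β ≤ 1) (hg : 0 < g) :
    ∃ ε C0 : ℝ, 0 < ε ∧ 0 < C0 ∧ ∀ α : ℝ, 0 < α → ∃ δ N : ℝ, 0 < δ ∧ 0 < N ∧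
      ∀ (p : ℕ) [Fact p.Prime] (A B : Finset (ZMod p)) (t : ℕ),
      0 < t → N ≤ A.card → C0 * A.card ≤ B.card → α * B.card ≤ A.card →
      (A.card : ℝ) + B.card ≤ (1 - β) * p → (t : ℝ) ≤ δ * A.card →
      (gg t A B : ℝ) ≤ t * (A.card + B.card + ε * A.card) →
      ∃ (d a0 : ZMod p) (len : ℕ), d ≠ 0 ∧
        ((symmDiff A (zmodAP p a0 d len)).card : ℝ) ≤ g * A.card := by
  obtain ⟨ε2, δ2, N2, hε2, hδ2, hN2, H⟩ := propII (g / 2) 1 1 (by linarith) one_pos one_pos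
  set κ : ℝ := min 1 (ε2 / 8) with hκ
  have hκ0 : 0 < κ := by positivity
  have hκ1 : κ ≤ 1 := min_le_left _ _
  have hκ2 : κ ≤ ε2 / 8 := min_le_right _ _
  obtain ⟨ε, hε0, hεa, hεb, hεc⟩ : ∃ ε : ℝ, 0 < ε ∧ ε ≤ 1 / 4 ∧ ε ≤ ε2 / 88 ∧ ε ≤ g / 2 :=
    ⟨min (1/4) (min (ε2 / 88) (g / 2)), by positivity, min_le_left _ _,
      (min_le_right _ _).trans (min_le_left _ _), (min_le_right _ _).trans (min_le_right _ _)⟩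
  set C0 : ℝ := 2 * (40 / κ + 2) / β with hC0
  have hC0pos : 0 < C0 := by positivity
  have hβC0 : β * C0 = 2 * (40 / κ + 2) := by rw [hC0]; field_simp
  have hC02 : 2 ≤ C0 := by
    have : 0 < 40 / κ := by positivity
    have h1 := mul_le_mul_of_nonneg_right hβ1 hC0pos.le
    linarith
  refine ⟨ε, C0, hε0, hC0pos, ?_⟩
  intro α hα
  refine ⟨ε ^ 2 / (2 + 1 / α), max (2 * N2) (max (2 / δ2) (4 / ε2)), by positivity, by positivity, ?_⟩
  intro p _ A B t ht hN hBC hαB hp htδ hgg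
  set a : ℝ := (A.card : ℝ) with haa
  set b : ℝ := (B.card : ℝ) with hbb
  have htR : (0:ℝ) < t := by exact_mod_cast ht
  have hN1 : 2 * N2 ≤ a := (le_max_left _ _).trans hN
  have hN3 : 2 / δ2 ≤ a := ((le_max_left _ _).trans (le_max_right _ _)).trans hN
  have hN4 : 4 / ε2 ≤ a := ((le_max_right _ _).trans (le_max_right _ _)).trans hN
  have ha0 : 0 < a := by linarith
  have hp0 : (0:ℝ) ≤ p := by positivity
  have hβp : 0 ≤ β * p := by positivity
  have h2ab : 2 * a ≤ b := (mul_le_mul_of_nonneg_right hC02 ha0.le).trans hBC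
  have hba : b ≤ 1 / α * a := by rw [div_mul_eq_mul_div, le_div_iff₀ hα]; linarith
  obtain ⟨A', hA'A, hA'c, hA'⟩ := good t ht A B (ε * a) (by positivity) hgg
  rw [← haa, ← hbb] at hA'c
  have hA'c2 : a - A'.card ≤ ε * a := by
    have q1 : a + b + ε * a ≤ (2 + 1 / α) * a := by
      have : ε * a ≤ 1 * a := mul_le_mul_of_nonneg_right (by linarith) ha0.le
      linarith
    have q2 : t * (a + b + ε * a) ≤ (ε ^ 2 / (2 + 1 / α) * a) * ((2 + 1 / α) * a) :=
      mul_le_mul htδ q1 (by positivity) (by positivity)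
    have q3 : (ε ^ 2 / (2 + 1 / α) * a) * ((2 + 1 / α) * a) = (ε * a) * (ε * a) := by
      field_simp
    exact le_of_mul_le_mul_right ((hA'c.trans q2).trans q3.le) (by positivity)
  set a' : ℝ := (A'.card : ℝ) with haa'
  have hεa4 : ε * a ≤ 1 / 4 * a := mul_le_mul_of_nonneg_right hεa ha0.le
  have ha' : a ≤ 2 * a' := by linarith
  have ha'a : a' ≤ a := by rw [haa, haa']; exact_mod_cast card_le_card hA'A
  have hA'ne : A'.Nonempty := by
    rw [← card_pos]
    have : (0:ℝ) < A'.card := by linarith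
    exact_mod_cast this
  set W := A' - A' with hW
  set r := ⌊a + 3 * (ε * a)⌋₊ with hr
  have hr1 : (r : ℝ) ≤ a + 3 * (ε * a) := Nat.floor_le (by positivity)
  have hr2 : A.card ≤ r := Nat.le_floor (by rw [← haa]; linarith [mul_pos hε0 ha0])
  have hA0 : 0 < A.card := by rw [haa] at ha0; exact_mod_cast ha0
  have hr0 : 0 < r := by omega
  have hr0R : (0:ℝ) < r := by exact_mod_cast hr0
  have hWr : ∀ w ∈ W, nn B w ≤ r := by
    intro w hw
    obtain ⟨x, hx, x', hx', rfl⟩ := mem_sub.1 hw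
    exact Nat.le_floor (hA' x hx x' hx')
  obtain ⟨C, hC1, hC2, hC3⟩ : ∃ C : Finset (ZMod p), 2 * C.card ≤ p ∧ (∀ w ∈ W, nn C w ≤ r) ∧ β * C0 * a ≤ C.card := by
    have hc : B.card + Bᶜ.card = p := by rw [card_add_card_compl, ZMod.card]
    by_cases hcase : 2 * B.card ≤ p
    · refine ⟨B, hcase, hWr, ?_⟩
      rw [← hbb]; have h1 := mul_le_mul_of_nonneg_right hβ1 (mul_pos hC0pos ha0).le; linarith
    · refine ⟨Bᶜ, by omega, fun w hw => by rw [nn_compl]; exact hWr w hw, ?_⟩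
      have hcR : b + (Bᶜ.card : ℝ) = p := by rw [hbb]; exact_mod_cast hc
      have : β * (C0 * a) ≤ β * p := mul_le_mul_of_nonneg_left (by linarith) hβ.le
      linarith
  have hnlt : C.card < (C.card / r + 1) * r := by rw [mul_comm]; exact Nat.lt_mul_div_succ _ hr0
  have hWc := lemI2 C W r (C.card / r) κ hκ0 hκ1 hr0 (Nat.div_mul_le_self _ _) hnlt hC1 (hA'ne.sub hA'ne) hC2 (by
    have e1 : (C.card : ℝ) < (((C.card / r : ℕ) : ℝ) + 1) * r := by exact_mod_cast hnlt
    have e2 : (40 / κ + 2) * r ≤ C.card := by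
      have : (r:ℝ) ≤ 2 * a := by linarith
      have : (40 / κ + 2) * r ≤ (40 / κ + 2) * (2 * a) := mul_le_mul_of_nonneg_left this (by positivity)
      rw [hβC0] at hC3; linarith
    have e3 : 40 / κ + 2 < ((C.card / r : ℕ) : ℝ) + 1 := lt_of_mul_lt_mul_right (e2.trans_lt e1) hr0R.le
    have e4 : 40 / κ ≤ ((C.card / r : ℕ) : ℝ) := by linarith
    rw [div_le_iff₀ hκ0] at e4; linarith)
  have hWfin : (W.card : ℝ) ≤ a' + a' + ε2 * a' := by
    have q1 : (2 + κ) * r ≤ (2 + κ) * (a + 3 * (ε * a)) := mul_le_mul_of_nonneg_left hr1 (by positivity)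
    have q2 : κ * (ε * a) ≤ 1 * (ε * a) := mul_le_mul_of_nonneg_right hκ1 (by positivity)
    have q3 : κ * a ≤ ε2 / 8 * a := mul_le_mul_of_nonneg_right hκ2 ha0.le
    have q4 : ε * a ≤ ε2 / 88 * a := mul_le_mul_of_nonneg_right hεb ha0.le
    have q5 : 4 ≤ ε2 * a := by rw [div_le_iff₀ hε2] at hN4; linarith
    have q6 : ε2 * a ≤ ε2 * (2 * a') := mul_le_mul_of_nonneg_left ha' hε2.le
    linarith
  have hpN : 3 * A'.card ≤ p := by
    have : 3 * a' ≤ p := by linarith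
    rw [haa'] at this; exact_mod_cast this
  obtain ⟨d, a0, len, hd, hf⟩ := H p A' (-A') 1 one_pos (by rw [← haa']; linarith) (by omega)
    (by rw [card_neg, one_mul]) (by rw [card_neg, one_mul]) (by rw [card_neg]; omega)
    (by
      rw [← haa']
      rw [div_le_iff₀ hδ2] at hN3
      have : δ2 * a ≤ δ2 * (2 * a') := mul_le_mul_of_nonneg_left ha' hδ2.le
      push_cast; linarith)
    (by
      rw [gg_comm, gg_one, ← sub_eq_add_neg, card_neg, ← hW, ← haa']
      push_cast; linarith)
  refine ⟨d, a0, len, hd, ?_⟩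
  have hs : (symmDiff A (zmodAP p a0 d len)).card ≤ (symmDiff A' (zmodAP p a0 d len)).card + (A \ A').card := by
    refine (card_le_card ?_).trans (card_union_le _ _)
    intro z
    have := @hA'A z
    simp only [mem_symmDiff, mem_union, mem_sdiff]; tauto
  have hsR : ((symmDiff A (zmodAP p a0 d len)).card : ℝ) ≤ (symmDiff A' (zmodAP p a0 d len)).card + (A \ A').card := by
    exact_mod_cast hs
  have hsd : ((A \ A').card : ℝ) = a - a' := by
    have := card_sdiff_add_card_eq_card hA'A
    have : ((A \ A').card : ℝ) + a' = a := by rw [haa, haa']; exact_mod_cast this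
    linarith
  rw [← haa'] at hf
  have : g / 2 * a' ≤ g / 2 * a := mul_le_mul_of_nonneg_left ha'a (by linarith)
  have : ε * a ≤ g / 2 * a := mul_le_mul_of_nonneg_right hεc ha0.le
  linarith

lemma propD (β g : ℝ) (hβ : 0 < β) (hβ1 : β ≤ 1) (hg : 0 < g) :
    ∃ ε : ℝ, 0 < ε ∧ ∀ α : ℝ, 0 < α → ∃ δ N : ℝ, 0 < δ ∧ 0 < N ∧
      ∀ (p : ℕ) [Fact p.Prime] (A B : Finset (ZMod p)) (t : ℕ),
      0 < t → N ≤ A.card → A.card ≤ B.card → α * B.card ≤ A.card →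
      (A.card : ℝ) + B.card ≤ (1 - β) * p → (t : ℝ) ≤ δ * A.card →
      (gg t A B : ℝ) ≤ t * (A.card + B.card + ε * A.card) →
      ∃ (d a0 : ZMod p) (len : ℕ), d ≠ 0 ∧
        ((symmDiff A (zmodAP p a0 d len)).card : ℝ) ≤ g * A.card := by
  obtain ⟨ε1, C0, hε1, hC0, H1⟩ := caseI β g hβ hβ1 hg
  obtain ⟨ε2, δ2, N2, hε2, hδ2, hN2, H2⟩ := caseII β g C0 hβ hβ1 hg hC0
  refine ⟨min ε1 ε2, by positivity, fun α hα => ?_⟩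
  obtain ⟨δ1, N1, hδ1, hN1, H1⟩ := H1 α hα
  refine ⟨min δ1 δ2, max N1 N2, by positivity, by positivity, ?_⟩
  intro p _ A B t ht hN hAB hαB hp htδ hgg
  have hA0 : (0:ℝ) ≤ A.card := by positivity
  have ht0 : (0:ℝ) ≤ t := by positivity
  by_cases hc : C0 * A.card ≤ B.card
  · apply H1 p A B t ht ((le_max_left _ _).trans hN) hc hαB hp
      (htδ.trans (mul_le_mul_of_nonneg_right (min_le_left _ _) hA0))
    refine hgg.trans (mul_le_mul_of_nonneg_left ?_ ht0)
    have := mul_le_mul_of_nonneg_right (min_le_left ε1 ε2) hA0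
    linarith
  · apply H2 p A B t ht ((le_max_right _ _).trans hN) hAB (not_le.1 hc).le hp
      (htδ.trans (mul_le_mul_of_nonneg_right (min_le_right _ _) hA0))
    refine hgg.trans (mul_le_mul_of_nonneg_left ?_ ht0)
    have := mul_le_mul_of_nonneg_right (min_le_right ε1 ε2) hA0
    linarith
end propD2

section propS
variable {p : ℕ} [Fact p.Prime]

lemma ap_card (a d : ZMod p) (hd : d ≠ 0) (L : ℕ) (hL : L ≤ p) : (zmodAP p a d L).card = L := by
  unfold zmodAP
  rw [card_image_of_injOn, card_range]
  intro i hi j hj hij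
  simp only [coe_range, Set.mem_Iio] at hi hj
  have h1 : (i : ZMod p) = j := mul_right_cancel₀ hd (add_left_cancel hij)
  rw [ZMod.natCast_eq_natCast_iff'] at h1
  rwa [Nat.mod_eq_of_lt (by omega), Nat.mod_eq_of_lt (by omega)] at h1

lemma ap_card_le (a d : ZMod p) (L : ℕ) : (zmodAP p a d L).card ≤ L := by
  unfold zmodAP
  exact card_image_le.trans (by simp)

lemma mem_ap (a d z : ZMod p) (L : ℕ) : z ∈ zmodAP p a d L ↔ ∃ i : ℕ, i < L ∧ a + i * d = z := by
  simp [zmodAP]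

lemma ap_inter (a d z : ZMod p) (hd : d ≠ 0) (L h : ℕ) (hp : L + h ≤ p)
    (h1 : z ∈ zmodAP p a d L) (h2 : z - h * d ∈ zmodAP p a d L) :
    z ∈ zmodAP p (a + h * d) d (L - h) := by
  rw [mem_ap] at *
  obtain ⟨i, hi, e1⟩ := h1
  obtain ⟨j, hj, e2⟩ := h2
  have e3 : ((i : ℕ) : ZMod p) = ((j + h : ℕ) : ZMod p) := by
    apply mul_right_cancel₀ hd
    push_cast
    linear_combination e1 - e2
  rw [ZMod.natCast_eq_natCast_iff', Nat.mod_eq_of_lt (by omega), Nat.mod_eq_of_lt (by omega)] at e3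
  refine ⟨j, by omega, ?_⟩
  linear_combination e2

lemma ap_sub1 (a d z : ZMod p) (L h : ℕ) (h1 : z ∈ zmodAP p (a + h * d) d (L - h)) :
    z ∈ zmodAP p a d L ∧ z - h * d ∈ zmodAP p a d L := by
  rw [mem_ap] at *
  obtain ⟨i, hi, e1⟩ := h1
  refine ⟨⟨i + h, by omega, ?_⟩, ?_⟩
  · push_cast; linear_combination e1
  · rw [mem_ap]; exact ⟨i, by omega, by linear_combination e1⟩

lemma ap_union (a d : ZMod p) (L h : ℕ) :
    zmodAP p a d L ∪ tr (zmodAP p a d L) (h * d) ⊆ zmodAP p a d (L + h) := by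
  intro z hz
  rw [mem_union, mem_tr, mem_ap, mem_ap] at hz
  rw [mem_ap]
  rcases hz with ⟨i, hi, e⟩ | ⟨i, hi, e⟩
  · exact ⟨i, by omega, e⟩
  · exact ⟨i + h, by omega, by push_cast; linear_combination e⟩

lemma symm_le1 (X J : Finset (ZMod p)) : X.card ≤ J.card + (symmDiff X J).card := by
  refine (card_le_card ?_).trans (card_union_le _ _)
  intro z; simp only [mem_symmDiff, mem_union]; tauto

lemma iter (B : Finset (ZMod p)) (t : ℕ) (d : ZMod p) (hd : d ≠ 0) (h : ℕ) (htB : t ≤ B.card) (n : ℕ) :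
    ∀ (X : Finset (ZMod p)) (a0 : ZMod p) (L e : ℕ) (D : ℝ),
      (symmDiff X (zmodAP p a0 d L)).card ≤ e → n * h + t + 2 ^ n * e ≤ L →
      B.card + L + h + 2 ^ (n + 1) * e ≤ p → 
      (gg t X B : ℝ) ≤ t * (X.card + B.card + D) →
      ∃ X' a', (symmDiff X' (zmodAP p a' d (L - n * h))).card ≤ 2 ^ n * e ∧
        (gg t X' B : ℝ) ≤ t * (X'.card + B.card + 2 ^ n * (D + t)) := by
  induction n with
  | zero =>
    intro X a0 L e D h1 h2 h3 h4
    refine ⟨X, a0, by simpa using h1, h4.trans ?_⟩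
    apply mul_le_mul_of_nonneg_left _ (by positivity)
    have : (0:ℝ) ≤ t := by positivity
    simp; 
  | succ n ih =>
    intro X a0 L e D h1 h2 h3 h4
    have hpw : 1 ≤ 2 ^ n := Nat.one_le_two_pow
    have hpe : e ≤ 2 ^ n * e := Nat.le_mul_of_pos_left _ (by positivity)
    have hp1 : 2 ^ (n + 1) * e = 2 * (2 ^ n * e) := by ring
    have hp2 : 2 ^ (n + 1 + 1) * e = 4 * (2 ^ n * e) := by ring
    have hn1 : (n + 1) * h = n * h + h := by ring
    rw [hp1, hn1] at h2
    rw [hp2] at h3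
    set J := zmodAP p a0 d L with hJ
    have hJc : J.card = L := ap_card _ _ hd _ (by omega)
    have hXc : t ≤ X.card := by
      have := symm_le1 J X
      rw [symmDiff_comm] at this
      omega
    have hU : (X ∪ tr X (h * d)).card ≤ L + h + 2 * e := by
      have s1 : X ∪ tr X (h * d) ⊆ zmodAP p a0 d (L + h) ∪ ((symmDiff X J) ∪ tr (symmDiff X J) (h * d)) := by
        intro z hz
        have hu := @ap_union p _ a0 d L h z
        rw [← hJ] at hu
        simp only [mem_union, mem_tr, mem_symmDiff] at *
        tauto
      refine (card_le_card s1).trans ((card_union_le _ _).trans ?_)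
      have := card_union_le (symmDiff X J) (tr (symmDiff X J) (h * d))
      rw [card_tr] at this
      have := ap_card_le a0 d (L + h)
      omega
    have hst := step t X B (h * d) D htB hXc (by omega) h4
    have hsd : (symmDiff (X ∩ tr X (h * d)) (zmodAP p (a0 + h * d) d (L - h))).card ≤ 2 * e := by
      have s1 : symmDiff (X ∩ tr X (h * d)) (zmodAP p (a0 + h * d) d (L - h)) ⊆ (symmDiff X J) ∪ tr (symmDiff X J) (h * d) := by
        intro z hz
        have i1 := ap_inter a0 d z hd L h (by omega)
        have i2 := ap_sub1 a0 d z L h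
        rw [← hJ] at i1 i2
        simp only [mem_union, mem_tr, mem_symmDiff, mem_inter] at *
        tauto
      refine (card_le_card s1).trans ((card_union_le _ _).trans ?_)
      rw [card_tr]; omega
    obtain ⟨X', a', r1, r2⟩ := ih _ (a0 + h * d) (L - h) (2 * e) (2 * D + t) hsd
      (by rw [show 2 ^ n * (2 * e) = 2 * (2 ^ n * e) by ring]; omega)
      (by rw [show 2 ^ (n + 1) * (2 * e) = 4 * (2 ^ n * e) by ring]; omega) hst
    refine ⟨X', a', ?_, ?_⟩
    · rw [show L - (n + 1) * h = L - h - n * h by rw [hn1]; omega]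
      rw [hp1]; rw [show 2 ^ n * (2 * e) = 2 * (2 ^ n * e) by ring] at r1; exact r1
    · refine r2.trans (le_of_eq ?_)
      ring
end propS

section propS2

lemma propS_end {p : ℕ} [Fact p.Prime] (B X : Finset (ZMod p)) (t : ℕ) (ht : 0 < t) (d a' : ZMod p) (hd : d ≠ 0) (L : ℕ)
    (hL : 1000 ≤ L) (hLp : L ≤ p) (hX : ((symmDiff X (zmodAP p a' d L)).card : ℝ) ≤ L / 100)
    (hgg : (gg t X B : ℝ) ≤ t * (X.card + B.card + (L:ℝ) / 100))
    (ht2 : (t : ℝ) * (X.card + B.card + (L:ℝ) / 100) ≤ ((L:ℝ) / 100) * ((L : ℝ) / 100))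
    (h1 : 20 * L < B.card) (h2 : 20 * L + B.card < p) :
    ∃ (a : ZMod p) (len : ℕ), (symmDiff B (zmodAP p a d len)).card ≤ 20 * L := by
  have hLR : (1000:ℝ) ≤ L := by exact_mod_cast hL
  have hL100 : (0:ℝ) < L / 100 := by positivity
  obtain ⟨X', hX'X, hX'c, hX'⟩ := good t ht X B ((L:ℝ) / 100) hL100 hgg
  have hc : (X.card : ℝ) - X'.card ≤ L / 100 := le_of_mul_le_mul_right (hX'c.trans ht2) hL100
  set J := zmodAP p a' d L with hJ
  have hJc : J.card = L := ap_card _ _ hd _ hLp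
  set T := X' ∩ J with hT
  have hXc : X.card ≤ L + (symmDiff X J).card := by rw [← hJc]; exact symm_le1 X J
  have hXcR : (X.card : ℝ) ≤ L + (symmDiff X J).card := by exact_mod_cast hXc
  have hJT : J.card ≤ T.card + ((symmDiff X J).card + (X \ X').card) := by
    refine (card_le_card ?_).trans ((card_union_le _ _).trans (Nat.add_le_add_left (card_union_le _ _) _))
    intro z
    simp only [hT, mem_union, mem_inter, mem_symmDiff, mem_sdiff]
    tauto
  have hsd : (X \ X').card + X'.card = X.card := card_sdiff_add_card_eq_card hX'X
  have hsdR : ((X \ X').card : ℝ) + X'.card = X.card := by exact_mod_cast hsd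
  have hTc : (98:ℝ) / 100 * L ≤ T.card := by
    rw [hJc] at hJT
    have : (L : ℝ) ≤ T.card + ((symmDiff X J).card + (X \ X').card) := by exact_mod_cast hJT
    linarith
  have hTN : 98 * L ≤ 100 * T.card := by
    have : (98 : ℝ) * L ≤ 100 * T.card := by linarith
    exact_mod_cast this
  set l := 95 * L / 800 with hl
  have hnn : ∀ x : ℕ, x ≤ 8 * l → nn B (x * d) ≤ 10 * l := by
    intro x hx
    obtain ⟨y, hy, y', hy', e⟩ := gap T a' d (L - 1) x (by
      intro y hy
      have : y ∈ J := (mem_inter.1 hy).2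
      rw [hJ, mem_ap] at this
      obtain ⟨i, hi, e⟩ := this
      exact ⟨i, by omega, e.symm⟩) (by omega)
    rw [← e]
    have h3 := hX' y (mem_inter.1 hy).1 y' (mem_inter.1 hy').1
    have h4 : (100:ℝ) * nn B (y - y') ≤ 104 * L := by linarith
    have h5 : 100 * nn B (y - y') ≤ 104 * L := by exact_mod_cast h4
    omega
  obtain ⟨a, len, h⟩ := lemT B d hd l (by omega) hnn (by omega) (by omega)
  exact ⟨a, len, by omega⟩

set_option maxHeartbeats 1600000 in
lemma propS (β γ : ℝ) (hβ : 0 < β) (hβ1 : β ≤ 1) (hγ : 0 < γ) :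
    ∃ g ε : ℝ, 0 < g ∧ g ≤ γ ∧ 0 < ε ∧ ∀ α : ℝ, 0 < α → ∃ δ N : ℝ, 0 < δ ∧ 0 < N ∧
      ∀ (p : ℕ) [Fact p.Prime] (A B : Finset (ZMod p)) (t : ℕ),
      0 < t → N ≤ A.card → A.card ≤ B.card → α * B.card ≤ A.card →
      (A.card : ℝ) + B.card ≤ (1 - β) * p → (t : ℝ) ≤ δ * A.card →
      (gg t A B : ℝ) ≤ t * (A.card + B.card + ε * A.card) →
      ∀ (d a0 : ZMod p) (len : ℕ), d ≠ 0 →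
        ((symmDiff A (zmodAP p a0 d len)).card : ℝ) ≤ g * A.card →
      ∃ (aQ : ZMod p) (lQ : ℕ), ((symmDiff B (zmodAP p aQ d lQ)).card : ℝ) ≤ γ * A.card := by
  obtain ⟨s, hs0, hs1, hs2⟩ : ∃ s : ℝ, 0 < s ∧ s ≤ 1 / 100 ∧ s ≤ γ / 50 :=
    ⟨min (1 / 100) (γ / 50), by positivity, min_le_left _ _, min_le_right _ _⟩
  set n := ⌈2 / β⌉₊ with hn
  have hnβ : 2 / β ≤ n := Nat.le_ceil _
  have hn0 : (0:ℝ) < n := lt_of_lt_of_le (by positivity) hnβ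
  have hn0N : 0 < n := by exact_mod_cast hn0
  set K : ℝ := 2 ^ n with hK
  have hK1 : 1 ≤ K := one_le_pow₀ (by norm_num)
  have hK0 : 0 < K := by linarith
  obtain ⟨g, hg0, hg1, hg2, hg3⟩ : ∃ g : ℝ, 0 < g ∧ K * g ≤ s / 100 ∧ g ≤ γ ∧ K * g ≤ β / 8 := by
    refine ⟨min (s / 100 / K) (min γ (β / 8 / K)), by positivity, ?_, (min_le_right _ _).trans (min_le_left _ _), ?_⟩
    · have := min_le_left (s / 100 / K) (min γ (β / 8 / K))
      rw [le_div_iff₀ hK0] at this; linarith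
    · have := (min_le_right (s / 100 / K) (min γ (β / 8 / K))).trans (min_le_right _ _)
      rw [le_div_iff₀ hK0] at this; linarith
  refine ⟨g, s / 200 / K, hg0, hg2, by positivity, fun α hα => ?_⟩
  obtain ⟨δ, hδ0, hδ1, hδ2⟩ : ∃ δ : ℝ, 0 < δ ∧ K * δ ≤ s / 200 ∧ δ * (3 + 1 / α) ≤ (s / 100) * (s / 100) := by
    refine ⟨min (s / 200 / K) ((s / 100) * (s / 100) / (3 + 1 / α)), by positivity, ?_, ?_⟩
    · have := min_le_left (s / 200 / K) ((s / 100) * (s / 100) / (3 + 1 / α))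
      rw [le_div_iff₀ hK0] at this; linarith
    · have := min_le_right (s / 200 / K) ((s / 100) * (s / 100) / (3 + 1 / α))
      rwa [le_div_iff₀ (by positivity)] at this
  refine ⟨δ, max (2000 / s) (2 * (n + 1) / s), hδ0, by positivity, ?_⟩
  intro p _ A B t ht hN hAB hαB hp htδ hgg d a0 len hd hA
  set a : ℝ := (A.card : ℝ) with haa
  set b : ℝ := (B.card : ℝ) with hbb
  have hab : a ≤ b := by rw [haa, hbb]; exact_mod_cast hAB
  have hN1 : 2000 ≤ s * a := by
    have := (le_max_left _ _).trans hN
    rw [div_le_iff₀ hs0] at this; linarith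
  have hN2 : 2 * (n + 1) ≤ s * a := by
    have := (le_max_right _ _).trans hN
    rw [div_le_iff₀ hs0] at this; linarith
  have ha0 : 0 < a := by
    by_contra hcon
    have : s * a ≤ 0 := mul_nonpos_of_nonneg_of_nonpos hs0.le (not_lt.1 hcon)
    linarith
  have hsa : s * a ≤ 1 / 100 * a := mul_le_mul_of_nonneg_right hs1 ha0.le
  have hKga : K * g * a ≤ s / 100 * a := mul_le_mul_of_nonneg_right hg1 ha0.le
  have hga : g * a ≤ K * g * a := by
    have : 1 * (g * a) ≤ K * (g * a) := mul_le_mul_of_nonneg_right hK1 (by positivity)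
    linarith
  have hKga2 : K * g * a ≤ β / 8 * a := mul_le_mul_of_nonneg_right hg3 ha0.le
  have hβp : β * (2 * a) ≤ β * p := by
    apply mul_le_mul_of_nonneg_left _ hβ.le
    have : 0 ≤ β * p := by positivity
    linarith
  have hβa0 : 0 < β * a := by positivity
  have hpR : a + b + 2 * (β * a) ≤ p := by linarith
  -- len
  have hlenp : len ≤ p := by
    by_contra hcon
    push Not at hcon
    have hs : zmodAP p a0 d p ⊆ zmodAP p a0 d len := by
      intro z hz
      rw [mem_ap] at *
      obtain ⟨i, hi, e⟩ := hz
      exact ⟨i, by omega, e⟩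
    have h3 := card_le_card hs
    rw [ap_card _ _ hd _ le_rfl] at h3
    have h4 := symm_le1 (zmodAP p a0 d len) A
    rw [symmDiff_comm] at h4
    have h5 : p ≤ A.card + (symmDiff A (zmodAP p a0 d len)).card := h3.trans h4
    have h6 : (p:ℝ) ≤ a + (symmDiff A (zmodAP p a0 d len)).card := by rw [haa]; exact_mod_cast h5
    linarith
  set e := (symmDiff A (zmodAP p a0 d len)).card with he
  have hlc := ap_card a0 d hd len hlenp
  have hl1 : (len : ℝ) ≤ a + e := by
    have h4 := symm_le1 (zmodAP p a0 d len) A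
    rw [symmDiff_comm, hlc] at h4
    rw [haa]; exact_mod_cast h4
  have hl2 : a ≤ len + e := by
    have h4 := symm_le1 A (zmodAP p a0 d len)
    rw [hlc] at h4
    rw [haa]; exact_mod_cast h4
  set m := ⌈s * a⌉₊ with hm
  have hm1 : s * a ≤ m := Nat.le_ceil _
  have hm2 : (m : ℝ) < s * a + 1 := Nat.ceil_lt_add_one (by positivity)
  have hmlen : m ≤ len := by
    have : (m : ℝ) ≤ len := by linarith
    exact_mod_cast this
  set h := (len - m) / n with hh
  have hh1 : n * h ≤ len - m := Nat.mul_div_le _ _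
  have hh2 : len - m < n * h + n := by
    have := Nat.lt_mul_div_succ (len - m) hn0N
    rw [mul_add, mul_one] at this; exact this
  set L := len - n * h with hL
  have hLm : m ≤ L := by omega
  have hLm2 : L < m + n := by omega
  have hLm2R : (L:ℝ) < m + n := by exact_mod_cast hLm2
  have hLm1R : (m:ℝ) ≤ L := by exact_mod_cast hLm
  have hLsa : s * a ≤ L := by linarith
  have hLsa2 : (L:ℝ) ≤ 2 * (s * a) := by linarith
  have hhR : (h:ℝ) ≤ β * a := by
    have q1 : n * h ≤ len := by omega
    have q2 : (n:ℝ) * h ≤ len := by exact_mod_cast q1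
    have q3 : 2 ≤ n * β := by rwa [div_le_iff₀ hβ] at hnβ
    have q4 : 2 * a ≤ n * β * a := mul_le_mul_of_nonneg_right q3 ha0.le
    have q5 : (n:ℝ) * h ≤ n * (β * a) := by linarith
    exact le_of_mul_le_mul_left q5 hn0
  have hKe : K * e ≤ K * g * a := by
    have := mul_le_mul_of_nonneg_left hA hK0.le
    linarith
  have hKt : K * t ≤ s / 200 * a := by
    have q1 := mul_le_mul_of_nonneg_left htδ hK0.le
    have q2 := mul_le_mul_of_nonneg_right hδ1 ha0.le
    linarith
  have htR : (0:ℝ) < t := by exact_mod_cast ht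
  have ht1 : (t:ℝ) ≤ K * t := by
    have := mul_le_mul_of_nonneg_right hK1 htR.le
    linarith
  have htB : t ≤ B.card := by
    have : (t:ℝ) ≤ b := by linarith
    rw [hbb] at this; exact_mod_cast this
  have hc1 : n * h + t + 2 ^ n * e ≤ len := by
    have q1 : (t:ℝ) + 2 ^ n * e ≤ L := by rw [← hK]; linarith
    have q2 : t + 2 ^ n * e ≤ L := by exact_mod_cast q1
    omega
  have hc2 : B.card + len + h + 2 ^ (n + 1) * e ≤ p := by
    have q1 : b + len + h + 2 ^ (n + 1) * e ≤ (p:ℝ) := by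
      rw [pow_succ, ← hK]; linarith
    rw [hbb] at q1; exact_mod_cast q1
  obtain ⟨X, a', hX1, hX2⟩ := iter B t d hd h htB n A a0 len e (s / 200 / K * a) le_rfl hc1 hc2 hgg
  rw [← hL] at hX1
  have hX1R : ((symmDiff X (zmodAP p a' d L)).card : ℝ) ≤ K * e := by rw [hK]; exact_mod_cast hX1
  have hLp : L ≤ p := by omega
  have hXc : (X.card : ℝ) ≤ L + (symmDiff X (zmodAP p a' d L)).card := by
    have := symm_le1 X (zmodAP p a' d L)
    rw [ap_card _ _ hd _ hLp] at this
    exact_mod_cast this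
  have hba : b ≤ 1 / α * a := by rw [div_mul_eq_mul_div, le_div_iff₀ hα]; linarith
  obtain ⟨aQ, lQ, hQ⟩ := propS_end B X t ht d a' hd L (by
      have : (1000:ℝ) ≤ L := by linarith
      exact_mod_cast this) hLp (by linarith)
    (hX2.trans (by
      apply mul_le_mul_of_nonneg_left _ htR.le
      rw [← hK, ← hbb]
      have : K * (s / 200 / K * a + t) = s / 200 * a + K * t := by field_simp
      linarith))
    (by
      rw [← hbb]
      have q1 : (X.card : ℝ) + b + L / 100 ≤ (3 + 1 / α) * a := by linarith
      have q2 : t * ((X.card : ℝ) + b + L / 100) ≤ (δ * a) * ((3 + 1 / α) * a) :=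
        mul_le_mul htδ q1 (by positivity) (by positivity)
      have q3 : δ * (3 + 1 / α) * (a * a) ≤ (s / 100) * (s / 100) * (a * a) :=
        mul_le_mul_of_nonneg_right hδ2 (by positivity)
      have q4 : (s * a / 100) * (s * a / 100) ≤ (L / 100 : ℝ) * (L / 100) :=
        mul_le_mul (by linarith) (by linarith) (by positivity) (by positivity)
      linarith)
    (by
      have : (20:ℝ) * L < b := by linarith
      rw [hbb] at this; exact_mod_cast this)
    (by
      have : (20:ℝ) * L + b < p := by linarith
      rw [hbb] at this; exact_mod_cast this)
  refine ⟨aQ, lQ, ?_⟩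
  have hQR : ((symmDiff B (zmodAP p aQ d lQ)).card : ℝ) ≤ 20 * L := by exact_mod_cast hQ
  have : s * a ≤ γ / 50 * a := mul_le_mul_of_nonneg_right hs2 ha0.le
  linarith
end propS2

section prob

lemma cnt_erase {ι : Type*} [DecidableEq ι] (A : Finset ι) (x : ι) (hx : x ∈ A) (k : ℕ) (P : Finset ι → Prop) [DecidablePred P] :
    ((A.powersetCard (k + 1)).filter (fun S => x ∈ S ∧ P S)).card =
      (((A.erase x).powersetCard k).filter (fun S => P (insert x S))).card := by
  refine card_bij' (fun S _ => S.erase x) (fun S _ => insert x S) ?_ ?_ ?_ ?_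
  · intro S hS
    simp only [mem_filter, mem_powersetCard] at hS ⊢
    obtain ⟨⟨h1, h2⟩, h3, h4⟩ := hS
    refine ⟨⟨erase_subset_erase _ h1, by rw [card_erase_of_mem h3, h2]; rfl⟩, by rwa [insert_erase h3]⟩
  · intro S hS
    simp only [mem_filter, mem_powersetCard] at hS ⊢
    obtain ⟨⟨h1, h2⟩, h4⟩ := hS
    have hxS : x ∉ S := fun h => (mem_erase.1 (h1 h)).1 rfl
    refine ⟨⟨insert_subset hx (h1.trans (erase_subset _ _)), by rw [card_insert_of_notMem hxS, h2]⟩, mem_insert_self _ _, h4⟩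
  · intro S hS
    simp only [mem_filter] at hS
    exact insert_erase hS.2.1
  · intro S hS
    simp only [mem_filter, mem_powersetCard] at hS
    have hxS : x ∉ S := fun h => (mem_erase.1 (hS.1.1 h)).1 rfl
    exact erase_insert hxS

lemma cnt1 {ι : Type*} [DecidableEq ι] (A : Finset ι) (x : ι) (hx : x ∈ A) (c : ℕ) :
    ((A.powersetCard c).filter (fun S => x ∈ S)).card * A.card = c * (A.powersetCard c).card := by
  cases c with
  | zero =>
    simp
  | succ k =>
    have h := cnt_erase A x hx k (fun _ => True)
    simp only [and_true, filter_true] at h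
    rw [h, card_powersetCard, card_powersetCard, card_erase_of_mem hx]
    have hA : 0 < A.card := card_pos.2 ⟨x, hx⟩
    obtain ⟨n, hn⟩ : ∃ n, A.card = n + 1 := ⟨A.card - 1, by omega⟩
    rw [hn]
    have := Nat.add_one_mul_choose_eq n k
    simp only [Nat.add_sub_cancel]
    linarith

lemma cnt1R {ι : Type*} [DecidableEq ι] (A : Finset ι) (x : ι) (hx : x ∈ A) (c : ℕ) :
    (((A.powersetCard c).filter (fun S => x ∈ S)).card : ℝ) = (c / A.card) * (A.powersetCard c).card := by
  have h := cnt1 A x hx c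
  have hA : 0 < A.card := card_pos.2 ⟨x, hx⟩
  have hAR : (0:ℝ) < A.card := by exact_mod_cast hA
  have hR : (((A.powersetCard c).filter (fun S => x ∈ S)).card : ℝ) * A.card = c * (A.powersetCard c).card := by exact_mod_cast h
  field_simp
  exact hR

lemma cnt2R {ι : Type*} [DecidableEq ι] (A : Finset ι) (x y : ι) (hx : x ∈ A) (hy : y ∈ A) (hxy : x ≠ y) (c : ℕ) (hc : c ≤ A.card) :
    (((A.powersetCard c).filter (fun S => x ∈ S ∧ y ∈ S)).card : ℝ) ≤ (c / A.card) ^ 2 * (A.powersetCard c).card := by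
  cases c with
  | zero => simp
  | succ k =>
    have h := cnt_erase A x hx k (fun S => y ∈ S)
    simp only [mem_insert, hxy.symm, false_or] at h
    rw [h]
    have hye : y ∈ A.erase x := mem_erase.2 ⟨hxy.symm, hy⟩
    rw [cnt1R _ y hye]
    have h1 := cnt1R A x hx (k + 1)
    have h0 := cnt_erase A x hx k (fun _ => True)
    simp only [and_true, filter_true] at h0
    rw [h0] at h1
    rw [h1]
    have hn1 : 0 < (A.erase x).card := card_pos.2 ⟨y, hye⟩
    have hn2 : (A.erase x).card + 1 = A.card := card_erase_add_one hx
    rw [← hn2] at hc ⊢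
    set n := (A.erase x).card
    have hn1R : (0:ℝ) < n := by exact_mod_cast hn1
    have hcR : (k:ℝ) ≤ n := by
      have : k ≤ n := by omega
      exact_mod_cast this
    have hr : (k:ℝ) / n ≤ ((k + 1 : ℕ) : ℝ) / ((n + 1 : ℕ) : ℝ) := by
      push_cast
      rw [div_le_div_iff₀ hn1R (by positivity)]
      linarith
    calc (k:ℝ) / n * (((k + 1 : ℕ) : ℝ) / ((n + 1 : ℕ) : ℝ) * ((A.powersetCard (k+1)).card : ℝ))
        ≤ ((k + 1 : ℕ) : ℝ) / ((n + 1 : ℕ) : ℝ) * (((k + 1 : ℕ) : ℝ) / ((n + 1 : ℕ) : ℝ) * ((A.powersetCard (k+1)).card : ℝ)) :=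
          mul_le_mul_of_nonneg_right hr (by positivity)
      _ = _ := by ring

lemma ind_sum {ι : Type*} (Ω : Finset ι) (P : ι → Prop) [DecidablePred P] :
    ∑ w ∈ Ω, (if P w then (1:ℝ) else 0) = ((Ω.filter P).card : ℝ) := by
  rw [sum_boole]

variable {p : ℕ} [Fact p.Prime]

lemma prob_z (A B : Finset (ZMod p)) (c₁ c₂ : ℕ) (h1 : c₁ ≤ A.card) (h2 : c₂ ≤ B.card) (z : ZMod p) (q T : ℝ)
    (hq : q = ((c₁ : ℝ) / A.card) * ((c₂ : ℝ) / B.card)) (hq0 : 0 < q)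
    (hT : T = ((A.powersetCard c₁).card : ℝ) * ((B.powersetCard c₂).card : ℝ)) (hT0 : 0 < T) :
    (rep A B z * q) * T ≤ (1 + rep A B z * q) *
      (((A.powersetCard c₁ ×ˢ B.powersetCard c₂).filter (fun w => z ∈ w.1 + w.2)).card : ℝ) := by
  classical
  set Ω := A.powersetCard c₁ ×ˢ B.powersetCard c₂ with hΩ
  set S := A.filter (fun a => z - a ∈ B) with hS
  have hr : rep A B z = S.card := rfl
  rw [hr]
  set r : ℝ := (S.card : ℝ) with hrr
  set H := Ω.filter (fun w => z ∈ w.1 + w.2) with hH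
  have hSA : ∀ x ∈ S, x ∈ A ∧ z - x ∈ B := fun x hx => mem_filter.1 hx
  set f : Finset (ZMod p) × Finset (ZMod p) → ℝ := fun w => ∑ x ∈ S, if x ∈ w.1 ∧ z - x ∈ w.2 then (1:ℝ) else 0 with hf
  have hf0 : ∀ w, z ∉ w.1 + w.2 → f w = 0 := by
    intro w hw
    apply sum_eq_zero
    intro x _
    rw [if_neg]
    rintro ⟨g1, g2⟩
    exact hw (mem_add.2 ⟨x, g1, z - x, g2, by ring⟩)
  have hsum1 : ∑ w ∈ H, f w = ∑ w ∈ Ω, f w := by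
    rw [hH, sum_filter]
    apply sum_congr rfl
    intro w _
    split_ifs with h
    · rfl
    · exact (hf0 w h).symm
  have hsum2 : ∑ w ∈ H, f w ^ 2 ≤ ∑ w ∈ Ω, f w ^ 2 :=
    sum_le_sum_of_subset_of_nonneg (filter_subset _ _) (fun _ _ _ => sq_nonneg _)
  have hA : ∑ w ∈ Ω, f w = r * (q * T) := by
    rw [hf, sum_comm]
    rw [sum_congr rfl (g := fun _ => q * T), sum_const, nsmul_eq_mul]
    intro x hx
    rw [ind_sum]
    have : Ω.filter (fun w => x ∈ w.1 ∧ z - x ∈ w.2) =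
      ((A.powersetCard c₁).filter (fun s => x ∈ s)) ×ˢ ((B.powersetCard c₂).filter (fun s => z - x ∈ s)) := by
      rw [hΩ, ← filter_product]
    rw [this, card_product]
    push_cast
    rw [cnt1R A x (hSA x hx).1, cnt1R B (z - x) (hSA x hx).2, hq, hT]
    ring
  have hB : ∑ w ∈ Ω, f w ^ 2 ≤ r * (q * T) + r * (r * (q ^ 2 * T)) := by
    have e1 : ∀ w, f w ^ 2 = ∑ x ∈ S, ∑ y ∈ S, if (x ∈ w.1 ∧ y ∈ w.1) ∧ (z - x ∈ w.2 ∧ z - y ∈ w.2) then (1:ℝ) else 0 := by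
      intro w
      rw [sq, hf, sum_mul_sum]
      apply sum_congr rfl; intro x _
      apply sum_congr rfl; intro y _
      by_cases k1 : x ∈ w.1 <;> by_cases k2 : y ∈ w.1 <;> by_cases k3 : z - x ∈ w.2 <;>
        by_cases k4 : z - y ∈ w.2 <;> simp [k1, k2, k3, k4]
    simp_rw [e1]
    rw [sum_comm]
    have e2 : ∀ x ∈ S, ∑ w ∈ Ω, ∑ y ∈ S, (if (x ∈ w.1 ∧ y ∈ w.1) ∧ (z - x ∈ w.2 ∧ z - y ∈ w.2) then (1:ℝ) else 0)
        ≤ q * T + r * (q ^ 2 * T) := by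
      intro x hx
      rw [sum_comm]
      have e3 : ∀ y ∈ S, ∑ w ∈ Ω, (if (x ∈ w.1 ∧ y ∈ w.1) ∧ (z - x ∈ w.2 ∧ z - y ∈ w.2) then (1:ℝ) else 0)
        ≤ (if x = y then q * T else 0) + q ^ 2 * T := by
        intro y hy
        rw [ind_sum]
        have : Ω.filter (fun w => (x ∈ w.1 ∧ y ∈ w.1) ∧ (z - x ∈ w.2 ∧ z - y ∈ w.2)) =
          ((A.powersetCard c₁).filter (fun s => x ∈ s ∧ y ∈ s)) ×ˢ ((B.powersetCard c₂).filter (fun s => z - x ∈ s ∧ z - y ∈ s)) := by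
          rw [hΩ, ← filter_product]
        rw [this, card_product]
        push_cast
        by_cases hxy : x = y
        · subst hxy
          simp only [and_self, if_true]
          rw [cnt1R A x (hSA x hx).1, cnt1R B (z - x) (hSA x hx).2]
          have : 0 ≤ q ^ 2 * T := by positivity
          have : (c₁ : ℝ) / A.card * ((A.powersetCard c₁).card : ℝ) * ((c₂ : ℝ) / B.card * ((B.powersetCard c₂).card : ℝ)) = q * T := by
            rw [hq, hT]; ring
          linarith
        · rw [if_neg hxy, zero_add]
          have g1 := cnt2R A x y (hSA x hx).1 (hSA y hy).1 hxy c₁ h1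
          have g2 := cnt2R B (z - x) (z - y) (hSA x hx).2 (hSA y hy).2 (fun h => hxy (sub_right_injective h)) c₂ h2
          refine (mul_le_mul g1 g2 (by positivity) (by positivity)).trans (le_of_eq ?_)
          rw [hq, hT]; ring
      refine (sum_le_sum e3).trans (le_of_eq ?_)
      rw [sum_add_distrib, sum_ite_eq, if_pos hx, sum_const, nsmul_eq_mul]
    refine (sum_le_sum e2).trans (le_of_eq ?_)
    rw [sum_const, nsmul_eq_mul]; ring
  have hCS := sq_sum_le_card_mul_sum_sq (s := H) (f := f)
  rw [hsum1, hA] at hCS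
  have hfin : (r * (q * T)) ^ 2 ≤ H.card * (r * (q * T) + r * (r * (q ^ 2 * T))) :=
    hCS.trans (mul_le_mul_of_nonneg_left (hsum2.trans hB) (by positivity))
  by_cases hr0 : r = 0
  · rw [hr0]; simp
  · have hr1 : 0 < r := lt_of_le_of_ne (by positivity) (Ne.symm hr0)
    have hpos : 0 < r * q * T := by positivity
    apply le_of_mul_le_mul_left _ hpos
    linarith

lemma prob (A B : Finset (ZMod p)) (c₁ c₂ : ℕ) (hc1 : 1 ≤ c₁) (hc2 : 1 ≤ c₂) (h1 : c₁ ≤ A.card) (h2 : c₂ ≤ B.card) (t : ℕ) (q : ℝ)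
    (hq : q = ((c₁ : ℝ) / A.card) * ((c₂ : ℝ) / B.card)) :
    q * (gg t A B : ℝ) ≤ (1 + t * q) * ((∑ A' ∈ A.powersetCard c₁, ∑ B' ∈ B.powersetCard c₂, ((A' + B').card : ℝ)) /
                  (((A.powersetCard c₁).card : ℝ) * ((B.powersetCard c₂).card : ℝ))) := by
  classical
  have hA : (0:ℝ) < A.card := by exact_mod_cast (by omega : 0 < A.card)
  have hB : (0:ℝ) < B.card := by exact_mod_cast (by omega : 0 < B.card)
  have hc1R : (0:ℝ) < c₁ := by exact_mod_cast (by omega : 0 < c₁)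
  have hc2R : (0:ℝ) < c₂ := by exact_mod_cast (by omega : 0 < c₂)
  have hq0 : 0 < q := by rw [hq]; positivity
  have hT1 : (0:ℝ) < (A.powersetCard c₁).card := by
    rw [card_powersetCard]; exact_mod_cast Nat.choose_pos h1
  have hT2 : (0:ℝ) < (B.powersetCard c₂).card := by
    rw [card_powersetCard]; exact_mod_cast Nat.choose_pos h2
  set T : ℝ := ((A.powersetCard c₁).card : ℝ) * ((B.powersetCard c₂).card : ℝ) with hT
  have hT0 : 0 < T := mul_pos hT1 hT2
  have hS : (∑ A' ∈ A.powersetCard c₁, ∑ B' ∈ B.powersetCard c₂, ((A' + B').card : ℝ)) =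
      ∑ z : ZMod p, (((A.powersetCard c₁ ×ˢ B.powersetCard c₂).filter (fun w => z ∈ w.1 + w.2)).card : ℝ) := by
    rw [← sum_product' (f := fun A' B' : Finset (ZMod p) => ((A' + B').card : ℝ))]
    simp_rw [← ind_sum]
    rw [sum_comm]
    apply sum_congr rfl
    intro w _
    rw [ind_sum]
    congr 2
    ext z; simp
  rw [hS, ← mul_div_assoc, le_div_iff₀ hT0, mul_sum]
  unfold gg
  push_cast
  rw [mul_sum, sum_mul]
  apply sum_le_sum
  intro z _
  have h := prob_z A B c₁ c₂ h1 h2 z q T hq hq0 hT hT0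
  set P : ℝ := (((A.powersetCard c₁ ×ˢ B.powersetCard c₂).filter (fun w => z ∈ w.1 + w.2)).card : ℝ) with hP
  have hP0 : 0 ≤ P := by positivity
  set r : ℝ := (rep A B z : ℝ) with hr
  have hr0 : 0 ≤ r := by positivity
  have ht0 : (0:ℝ) ≤ t := by positivity
  rcases le_total r t with hrt | hrt
  · rw [min_eq_left hrt]
    have : r * q * P ≤ t * q * P := by
      apply mul_le_mul_of_nonneg_right _ hP0
      exact mul_le_mul_of_nonneg_right hrt hq0.le
    linarith
  · rw [min_eq_right hrt]
    have hpos : 0 < 1 + r * q := by positivity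
    apply le_of_mul_le_mul_left _ hpos
    have k1 : (1 + t * q) * (r * q * T) ≤ (1 + t * q) * ((1 + r * q) * P) :=
      mul_le_mul_of_nonneg_left h (by positivity)
    have k2 : t * (q * T) ≤ r * (q * T) := mul_le_mul_of_nonneg_right hrt (by positivity)
    linarith
end prob

section fin

lemma core (β γ : ℝ) (hβ : 0 < β) (hβ1 : β ≤ 1) (hγ : 0 < γ) :
    ∃ ε : ℝ, 0 < ε ∧ ∀ α : ℝ, 0 < α → ∃ δ N : ℝ, 0 < δ ∧ 0 < N ∧
      ∀ (p : ℕ) [Fact p.Prime] (A B : Finset (ZMod p)) (t : ℕ),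
      0 < t → N ≤ A.card → A.card ≤ B.card → α * B.card ≤ A.card →
      (A.card : ℝ) + B.card ≤ (1 - β) * p → (t : ℝ) ≤ δ * A.card →
      (gg t A B : ℝ) ≤ t * (A.card + B.card + ε * A.card) →
      ∃ (aP aQ d : ZMod p) (lP lQ : ℕ), ((symmDiff A (zmodAP p aP d lP)).card : ℝ) ≤ γ * A.card ∧
        ((symmDiff B (zmodAP p aQ d lQ)).card : ℝ) ≤ γ * A.card := by
  obtain ⟨g, ε1, hg, hgγ, hε1, H1⟩ := propS β γ hβ hβ1 hγ
  obtain ⟨ε2, hε2, H2⟩ := propD β g hβ hβ1 hg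
  refine ⟨min ε1 ε2, by positivity, fun α hα => ?_⟩
  obtain ⟨δ1, N1, hδ1, hN1, H1⟩ := H1 α hα
  obtain ⟨δ2, N2, hδ2, hN2, H2⟩ := H2 α hα
  refine ⟨min δ1 δ2, max N1 N2, by positivity, by positivity, ?_⟩
  intro p _ A B t ht hN hAB hαB hp htδ hgg
  have hA0 : (0:ℝ) ≤ A.card := by positivity
  have ht0 : (0:ℝ) ≤ t := by positivity
  obtain ⟨d, a0, len, hd, hA⟩ := H2 p A B t ht ((le_max_right _ _).trans hN) hAB hαB hp
      (htδ.trans (mul_le_mul_of_nonneg_right (min_le_right _ _) hA0)) (by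
    refine hgg.trans (mul_le_mul_of_nonneg_left ?_ ht0)
    have := mul_le_mul_of_nonneg_right (min_le_right ε1 ε2) hA0
    linarith)
  obtain ⟨aQ, lQ, hB⟩ := H1 p A B t ht ((le_max_left _ _).trans hN) hAB hαB hp
      (htδ.trans (mul_le_mul_of_nonneg_right (min_le_left _ _) hA0)) (by
    refine hgg.trans (mul_le_mul_of_nonneg_left ?_ ht0)
    have := mul_le_mul_of_nonneg_right (min_le_left ε1 ε2) hA0
    linarith) d a0 len hd hA
  exact ⟨a0, aQ, d, len, lQ, hA.trans (mul_le_mul_of_nonneg_right hgγ hA0), hB⟩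

end fin

theorem stmt7 (β γ : ℝ) (hβ : 0 < β) (hγ : 0 < γ) :
    ∃ ε : ℝ, 0 < ε ∧
      ∀ α : ℝ, 0 < α →
        ∃ c : ℝ, 0 < c ∧
          ∀ (p : ℕ), p.Prime →
            ∀ A B : Finset (ZMod p), ∀ c₁ c₂ : ℕ,
              1 ≤ c₁ → c₁ ≤ A.card → 1 ≤ c₂ → c₂ ≤ B.card →
              c * (max A.card B.card : ℕ) ≤ (c₁ * c₂ : ℝ) →
              2 ≤ min A.card B.card →
              α * B.card ≤ (A.card : ℝ) → (A.card : ℝ) ≤ α⁻¹ * B.card →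
              (A.card : ℝ) + B.card ≤ (1 - β) * p →
              (∑ A' ∈ A.powersetCard c₁, ∑ B' ∈ B.powersetCard c₂, ((A' + B').card : ℝ)) /
                  (((A.powersetCard c₁).card : ℝ) * ((B.powersetCard c₂).card : ℝ)) ≤
                (A.card : ℝ) + B.card - 1 + ε * (min A.card B.card : ℕ) →
              ∃ (aP aQ d : ZMod p) (ℓP ℓQ : ℕ),
                ((symmDiff A (zmodAP p aP d ℓP)).card : ℝ) ≤ γ * (min A.card B.card : ℕ) ∧
                ((symmDiff B (zmodAP p aQ d ℓQ)).card : ℝ) ≤ γ * (min A.card B.card : ℕ) := by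
  obtain ⟨ε, hε, H⟩ := core (min β 1) γ (by positivity) (min_le_right _ _) hγ
  obtain ⟨ε', hε'0, hε'1, hε'2⟩ : ∃ ε' : ℝ, 0 < ε' ∧ ε' ≤ ε / 2 ∧ ε' ≤ 1 :=
    ⟨min (ε / 2) 1, by positivity, min_le_left _ _, min_le_right _ _⟩
  refine ⟨ε', hε'0, fun α hα => ?_⟩
  obtain ⟨δ, N, hδ, hN, H⟩ := H α hα
  set c := max N (max (2 / δ) (4 * (2 + 1 / α) / (ε * δ))) with hc
  have hc0 : 0 < c := by positivity
  refine ⟨c, hc0, ?_⟩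
  intro p hpp A B c₁ c₂ h1 h2 h3 h4 h5 h6 h7 h8 h9 h10
  haveI : Fact p.Prime := ⟨hpp⟩
  set M := max A.card B.card with hM
  set m := min A.card B.card with hm
  have hmM : m * M = A.card * B.card := min_mul_max _ _
  have hmMR : (m:ℝ) * M = A.card * B.card := by exact_mod_cast hmM
  have hadd : m + M = A.card + B.card := min_add_max _ _
  have haddR : (m:ℝ) + M = A.card + B.card := by exact_mod_cast hadd
  have hm0 : (0:ℝ) < m := by exact_mod_cast (by omega : 0 < m)
  have hmM' : m ≤ M := min_le_max
  have hM0 : (0:ℝ) < M := by exact_mod_cast (by omega : 0 < M)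
  have hc1 : (0:ℝ) < c₁ := by exact_mod_cast h1
  have hc2 : (0:ℝ) < c₂ := by exact_mod_cast h3
  have hA0 : (0:ℝ) < A.card := by exact_mod_cast (by omega : 0 < A.card)
  have hB0 : (0:ℝ) < B.card := by exact_mod_cast (by omega : 0 < B.card)
  have h7' : α * A.card ≤ (B.card : ℝ) := by
    rw [inv_mul_eq_div, le_div_iff₀ hα] at h8; linarith
  have hαM : α * M ≤ m := by
    rcases le_total A.card B.card with h | h
    · rw [hM, hm, max_eq_right h, min_eq_left h]; exact h7
    · rw [hM, hm, max_eq_left h, min_eq_right h]; exact h7'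
  have hMα : (M:ℝ) ≤ 1 / α * m := by rw [div_mul_eq_mul_div, le_div_iff₀ hα]; linarith
  have hcm : c ≤ m := by
    have : (c₁ * c₂ : ℝ) ≤ A.card * B.card := by
      exact_mod_cast Nat.mul_le_mul h2 h4
    exact le_of_mul_le_mul_right (by linarith : c * M ≤ m * M) hM0
  have hNm : N ≤ m := (le_max_left _ _).trans hcm
  have hδm : 2 ≤ δ * m := by
    have : 2 / δ ≤ m := ((le_max_left _ _).trans (le_max_right _ _)).trans hcm
    rw [div_le_iff₀ hδ] at this; linarith
  have hcε : 4 * (2 + 1 / α) ≤ c * (ε * δ) := by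
    have : 4 * (2 + 1 / α) / (ε * δ) ≤ c := (le_max_right _ _).trans (le_max_right _ _)
    rwa [div_le_iff₀ (by positivity)] at this
  set t := ⌊δ * m⌋₊ with ht
  have g1 : (t : ℝ) ≤ δ * m := Nat.floor_le (by positivity)
  have g2 : δ * m < t + 1 := Nat.lt_floor_add_one _
  have g3 : δ * m / 2 ≤ t := by linarith
  have htR : (0:ℝ) < t := by linarith
  have ht0 : 0 < t := by exact_mod_cast htR
  set q : ℝ := ((c₁ : ℝ) / A.card) * ((c₂ : ℝ) / B.card) with hq
  have hq0 : 0 < q := by positivity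
  have hqm : c ≤ q * m := by
    have : q * m * M = c₁ * c₂ := by
      rw [mul_assoc, hmMR, hq]; field_simp
    exact le_of_mul_le_mul_right (by rw [this]; exact h5) hM0
  have hpr := prob A B c₁ c₂ h1 h3 h2 h4 t q hq
  set E := (∑ A' ∈ A.powersetCard c₁, ∑ B' ∈ B.powersetCard c₂, ((A' + B').card : ℝ)) /
                  (((A.powersetCard c₁).card : ℝ) * ((B.powersetCard c₂).card : ℝ)) with hE
  have hE1 : E ≤ m + M + ε' * m := by rw [haddR]; linarith
  have hgg : (gg t A B : ℝ) ≤ t * (m + M + ε * m) := by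
    apply le_of_mul_le_mul_left _ hq0
    refine hpr.trans ((mul_le_mul_of_nonneg_left hE1 (by positivity)).trans ?_)
    have k1 : ε' * m ≤ 1 * m := mul_le_mul_of_nonneg_right hε'2 hm0.le
    have k2 : m + M + ε' * m ≤ (2 + 1 / α) * m := by linarith
    have k3 : ε' * m ≤ ε / 2 * m := mul_le_mul_of_nonneg_right hε'1 hm0.le
    have k4 : (t * q) * (m + M + ε' * m) ≤ (t * q) * (m + M + ε / 2 * m) :=
      mul_le_mul_of_nonneg_left (by linarith) (by positivity)
    have k5 : c * (ε * δ / 4 * m) ≤ q * m * (ε * δ / 4 * m) := mul_le_mul_of_nonneg_right hqm (by positivity)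
    have k6 : 4 * (2 + 1 / α) * (m / 4) ≤ c * (ε * δ) * (m / 4) := mul_le_mul_of_nonneg_right hcε (by positivity)
    have k7 : (δ * m / 2) * (q * (ε / 2 * m)) ≤ t * (q * (ε / 2 * m)) := mul_le_mul_of_nonneg_right g3 (by positivity)
    linarith
  have h9' : (m:ℝ) + M ≤ (1 - min β 1) * p := by
    rw [haddR]
    refine h9.trans (mul_le_mul_of_nonneg_right ?_ (by positivity))
    linarith [min_le_left β 1]
  rcases le_total A.card B.card with h | h
  · have e1 : M = B.card := max_eq_right h
    have e2 : m = A.card := min_eq_left h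
    rw [e1, e2] at hgg h9'
    rw [e2] at g1 hNm ⊢
    exact H p A B t ht0 hNm h h7 h9' g1 hgg
  · have e1 : M = A.card := max_eq_left h
    have e2 : m = B.card := min_eq_right h
    rw [e1, e2, gg_comm] at hgg
    rw [e1, e2] at h9'
    rw [e2] at g1 hNm ⊢
    obtain ⟨aP, aQ, d, lP, lQ, r1, r2⟩ := H p B A t ht0 hNm h h7' h9' g1 hgg
    exact ⟨aQ, aP, d, lQ, lP, r2, r1⟩
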